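/- arXiv:1606.06940 — 2 statements merged into one kernel-verified Lean document; each statement's English description precedes it below -/
import Mathlib

section
/- For any x-monotone angle sequence S, there exists a perimeter-canonical minimum-perimeter polygon P realizing S with r(T) ≥ r(B) whose perimeter satisfies peri(P) = 3·r(T) + r(B) + 2 + |e_L| + |e_R|, where |e_L| and |e_R| are the lengths of the leftmost and rightmost vertical edges. -/
/-- Cross product of two planar integer vectors. -/
def cross (d e : ℤ × ℤ) : ℤ := d.1 * e.2 - d.2 * e.1

/-- Membership in an axis-parallel lattice segment with endpoints `a`, `b`. -/
def onSeg (a b p : ℤ × ℤ) : Prop :=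
  min a.1 b.1 ≤ p.1 ∧ p.1 ≤ max a.1 b.1 ∧ min a.2 b.2 ≤ p.2 ∧ p.2 ≤ max a.2 b.2

/-- A simple rectilinear lattice polygon with `n` vertices: all edges are
axis-parallel, consecutive edges are perpendicular, and non-adjacent edges are
disjoint (adjacent edges meet only in their common endpoint). -/
structure RectPolygon (n : ℕ) where
  v : ZMod n → ℤ × ℤ
  nondeg : ∀ i, v (i + 1) ≠ v i
  axis : ∀ i, (v (i + 1)).1 = (v i).1 ∨ (v (i + 1)).2 = (v i).2
  alt : ∀ i, ((v (i + 1)).1 = (v i).1 ↔ (v (i + 2)).2 = (v (i + 1)).2)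
  simple : ∀ i j : ZMod n, j ≠ i → ∀ p : ℤ × ℤ,
    onSeg (v i) (v (i + 1)) p → onSeg (v j) (v (j + 1)) p →
    (j = i + 1 ∧ p = v j) ∨ (i = j + 1 ∧ p = v i)

namespace RectPolygon

variable {n : ℕ}

/-- Vector of edge `i` (from vertex `i` to vertex `i+1`). -/
def dvec (P : RectPolygon n) (i : ZMod n) : ℤ × ℤ := P.v (i + 1) - P.v i

/-- The turn at vertex `i` is a left (+90°, convex) turn. -/
def convexAt (P : RectPolygon n) (i : ZMod n) : Prop := 0 < cross (P.dvec (i - 1)) (P.dvec i)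

/-- The turn at vertex `i` is a right (−90°, reflex) turn. -/
def reflexAt (P : RectPolygon n) (i : ZMod n) : Prop := cross (P.dvec (i - 1)) (P.dvec i) < 0

def horiz (P : RectPolygon n) (i : ZMod n) : Prop := (P.v (i + 1)).2 = (P.v i).2

def vert (P : RectPolygon n) (i : ZMod n) : Prop := (P.v (i + 1)).1 = (P.v i).1

/-- Signed x-extent of edge `i`. -/
def sx (P : RectPolygon n) (i : ZMod n) : ℤ := (P.v (i + 1)).1 - (P.v i).1

/-- Signed y-extent of edge `i`. -/
def sy (P : RectPolygon n) (i : ZMod n) : ℤ := (P.v (i + 1)).2 - (P.v i).2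

/-- Length of edge `i`. -/
def elen (P : RectPolygon n) (i : ZMod n) : ℤ :=
  |(P.v (i + 1)).1 - (P.v i).1| + |(P.v (i + 1)).2 - (P.v i).2|

section
variable [NeZero n]

/-- Counterclockwise orientation (positive shoelace signed area). -/
def ccw (P : RectPolygon n) : Prop := 0 < ∑ i : ZMod n, cross (P.v i) (P.v (i + 1))

/-- The enclosed area of a ccw polygon (shoelace formula); for a rectilinear
lattice polygon this is the number of interior unit grid cells. -/
def area (P : RectPolygon n) : ℤ := (∑ i : ZMod n, cross (P.v i) (P.v (i + 1))) / 2

/-- Perimeter: total length of all edges. -/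
def perimeter (P : RectPolygon n) : ℤ := ∑ i : ZMod n, P.elen i

def maxX (P : RectPolygon n) : ℤ := Finset.univ.sup' Finset.univ_nonempty fun i : ZMod n => (P.v i).1
def minX (P : RectPolygon n) : ℤ := Finset.univ.inf' Finset.univ_nonempty fun i : ZMod n => (P.v i).1
def maxY (P : RectPolygon n) : ℤ := Finset.univ.sup' Finset.univ_nonempty fun i : ZMod n => (P.v i).2
def minY (P : RectPolygon n) : ℤ := Finset.univ.inf' Finset.univ_nonempty fun i : ZMod n => (P.v i).2

/-- Width of the bounding box (a single unit edge gives width 1). -/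
def width (P : RectPolygon n) : ℤ := P.maxX - P.minX

/-- Height of the bounding box. -/
def height (P : RectPolygon n) : ℤ := P.maxY - P.minY

/-- Area of the bounding box. -/
def bboxArea (P : RectPolygon n) : ℤ := P.width * P.height

end

/-- A simple rectilinear polygon is x-monotone iff the cyclic sequence of
x-directions of its horizontal edges has exactly two reversals. -/
def IsXMonotone (P : RectPolygon n) : Prop :=
  {i : ZMod n | P.horiz i ∧ P.sx i * P.sx (i + 2) < 0}.ncard = 2

def IsYMonotone (P : RectPolygon n) : Prop :=
  {i : ZMod n | P.vert i ∧ P.sy i * P.sy (i + 2) < 0}.ncard = 2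

def IsXYMonotone (P : RectPolygon n) : Prop := P.IsXMonotone ∧ P.IsYMonotone

/-- In a ccw x-monotone polygon, a reflex vertex lies on the upper chain iff its
adjacent horizontal edge points leftwards. -/
def upperReflex (P : RectPolygon n) (i : ZMod n) : Prop :=
  P.reflexAt i ∧ ((P.horiz (i - 1) ∧ P.sx (i - 1) < 0) ∨ (P.horiz i ∧ P.sx i < 0))

def lowerReflex (P : RectPolygon n) (i : ZMod n) : Prop :=
  P.reflexAt i ∧ ((P.horiz (i - 1) ∧ 0 < P.sx (i - 1)) ∨ (P.horiz i ∧ 0 < P.sx i))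

/-- Number of reflex vertices on the upper chain T. -/
noncomputable def rT (P : RectPolygon n) : ℕ := {i : ZMod n | P.upperReflex i}.ncard

/-- Number of reflex vertices on the lower chain B. -/
noncomputable def rB (P : RectPolygon n) : ℕ := {i : ZMod n | P.lowerReflex i}.ncard

end RectPolygon

/-- The block (LR)^k of an angle sequence (`true` = L, `false` = R). -/
def LRblock (k : ℕ) : List Bool := (List.replicate k [true, false]).flatten

/-- `P` realizes the angle sequence `S` via a counterclockwise boundary walk. -/
def realizes {m : ℕ} [NeZero m] (S : List Bool) (P : RectPolygon m) : Prop :=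
  m = S.length ∧ P.ccw ∧ ∀ i : Fin S.length,
    ((S.get i = true) ↔ P.convexAt ((i : ℕ) : ZMod m)) ∧
    ((S.get i = false) ↔ P.reflexAt ((i : ℕ) : ZMod m))

instance (k : ℕ) : NeZero (k + 4) := ⟨by omega⟩

/-- A perimeter-canonical x-monotone polygon: (P1) every vertical edge other than
the leftmost and rightmost vertical edges has unit length, and (P2) every
horizontal edge of the upper chain T (which points leftwards on a ccw walk) has
unit length. -/
def periCanonical {n : ℕ} [NeZero n] (P : RectPolygon n) : Prop :=
  (∀ i, P.vert i → (P.v i).1 ≠ P.minX → (P.v i).1 ≠ P.maxX → P.elen i = 1) ∧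
  (∀ i, P.horiz i → P.sx i < 0 → P.elen i = 1)


/-- Two `x`-monotone staircases over the same range of abscissae: the upper one has height `T i`
over `[X i, X (i + 1)]` for `i ≤ a`, the lower one has height `B j` over `[Y j, Y (j + 1)]` for
`j ≤ b`, and the upper one runs strictly above the lower one. -/
structure ChainPair (a b : ℕ) (X T Y B : ℕ → ℤ) : Prop where
  ltX : ∀ i ≤ a, X i < X (i + 1)
  ltY : ∀ j ≤ b, Y j < Y (j + 1)
  left : X 0 = Y 0
  right : X (a + 1) = Y (b + 1)
  neT : ∀ i < a, T (i + 1) ≠ T i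
  neB : ∀ j < b, B (j + 1) ≠ B j
  sep : ∀ i ≤ a, ∀ j ≤ b, X i ≤ Y (j + 1) → Y j ≤ X (i + 1) → B j < T i

lemma ChainPair.sep_left {a b : ℕ} {X T Y B : ℕ → ℤ} (h : ChainPair a b X T Y B) : B 0 < T 0 := by
  have h0 := h.left
  have h1 := h.ltX 0 (Nat.zero_le _)
  have h2 := h.ltY 0 (Nat.zero_le _)
  exact h.sep 0 (Nat.zero_le _) 0 (Nat.zero_le _) (by omega) (by omega)

lemma ChainPair.sep_right {a b : ℕ} {X T Y B : ℕ → ℤ} (h : ChainPair a b X T Y B) :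
    B b < T a := by
  have h0 := h.right
  have h1 := h.ltX a le_rfl
  have h2 := h.ltY b le_rfl
  exact h.sep a le_rfl b le_rfl (by omega) (by omega)

/-- The closed walk `v` runs from vertex `k` along the lower staircase to the right and then back
along the upper staircase. -/
structure Traces {n : ℕ} (v : ZMod n → ℤ × ℤ) (k : ZMod n) (a b : ℕ) (X T Y B : ℕ → ℤ) :
    Prop where
  len : n = 2 * a + 2 * b + 4
  lower_left : ∀ j ≤ b, v (k + ((2 * j : ℕ) : ZMod n)) = (Y j, B j)
  lower_right : ∀ j ≤ b, v (k + ((2 * j + 1 : ℕ) : ZMod n)) = (Y (j + 1), B j)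
  upper_left : ∀ i ≤ a, v (k + ((2 * a + 2 * b + 3 - 2 * i : ℕ) : ZMod n)) = (X i, T i)
  upper_right : ∀ i ≤ a, v (k + ((2 * a + 2 * b + 2 - 2 * i : ℕ) : ZMod n)) = (X (i + 1), T i)

/-! ### Step functions -/

lemma lt_of_step_lt {X : ℕ → ℤ} {m : ℕ} (h : ∀ i < m, X i < X (i + 1)) {i j : ℕ}
    (hij : i < j) (hj : j ≤ m) : X i + (j - i : ℕ) ≤ X j := by
  induction j with
  | zero => omega
  | succ j ih =>
    have h1 := h j (by omega)
    rcases Nat.lt_succ_iff_lt_or_eq.mp hij with h2 | rfl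
    · have := ih h2 (by omega)
      omega
    · omega

lemma le_of_step_lt {X : ℕ → ℤ} {m : ℕ} (h : ∀ i < m, X i < X (i + 1)) {i j : ℕ}
    (hij : i ≤ j) (hj : j ≤ m) : X i + (j - i : ℕ) ≤ X j := by
  rcases hij.lt_or_eq with h1 | rfl
  · exact lt_of_step_lt h h1 hj
  · simp

lemma exists_step {X : ℕ → ℤ} {m : ℕ} {c : ℤ} (h0 : X 0 ≤ c) (h1 : c < X m) :
    ∃ i < m, X i ≤ c ∧ c < X (i + 1) := by
  induction m with
  | zero => omega
  | succ m ih =>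
    by_cases h : c < X m
    · obtain ⟨i, hi, h2⟩ := ih h
      exact ⟨i, by omega, h2⟩
    · exact ⟨m, by omega, by omega, h1⟩

lemma sum_step {X T : ℕ → ℤ} {f : ℤ → ℤ} {m : ℕ} (h : ∀ i < m, X i < X (i + 1))
    (hf : ∀ i < m, ∀ c, X i ≤ c → c < X (i + 1) → f c = T i) :
    ∑ c ∈ Finset.Ico (X 0) (X m), f c = ∑ i ∈ Finset.range m, T i * (X (i + 1) - X i) := by
  induction m with
  | zero => simp
  | succ m ih =>
    have h1 := le_of_step_lt (fun i hi => h i (Nat.lt_succ_of_lt hi)) (Nat.zero_le m) le_rfl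
    have h2 := h m (by omega)
    rw [Finset.sum_range_succ, ← ih (fun i hi => h i (by omega)) (fun i hi => hf i (by omega)),
      ← Finset.Ico_union_Ico_eq_Ico (b := X m) (by omega) h2.le,
      Finset.sum_union (Finset.Ico_disjoint_Ico_consecutive _ _ _)]
    congr 1
    rw [Finset.sum_congr rfl (g := fun _ => T m)]
    · rw [Finset.sum_const, Int.card_Ico, nsmul_eq_mul, Int.toNat_of_nonneg (by omega), mul_comm]
    · intro c hc
      rw [Finset.mem_Ico] at hc
      exact hf m (by omega) c hc.1 hc.2

lemma exists_step_function {X : ℕ → ℤ} (T : ℕ → ℤ) {m : ℕ} (h : ∀ i < m, X i < X (i + 1)) :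
    ∃ f : ℤ → ℤ, ∀ i < m, ∀ c, X i ≤ c → c < X (i + 1) → f c = T i := by
  classical
  refine ⟨fun c => if hc : ∃ i < m, X i ≤ c ∧ c < X (i + 1) then T hc.choose else 0, ?_⟩
  intro i hi c h1 h2
  have hc : ∃ i < m, X i ≤ c ∧ c < X (i + 1) := ⟨i, hi, h1, h2⟩
  simp only [hc, dif_pos]
  obtain ⟨h3, h4, h5⟩ := hc.choose_spec
  generalize hc.choose = i' at *
  rcases lt_trichotomy i i' with h6 | h6 | h6
  · have := le_of_step_lt h (i := i + 1) h6 (by omega)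
    omega
  · rw [h6]
  · have := le_of_step_lt h (i := i' + 1) h6 (by omega)
    omega

/-- The area between two separated staircases is positive. -/
lemma area_pos_of_sep {a b : ℕ} {X T Y B : ℕ → ℤ} (ltX : ∀ i ≤ a, X i < X (i + 1))
    (ltY : ∀ j ≤ b, Y j < Y (j + 1)) (left : X 0 = Y 0) (right : X (a + 1) = Y (b + 1))
    (sep : ∀ i ≤ a, ∀ j ≤ b, X i ≤ Y (j + 1) → Y j ≤ X (i + 1) → B j < T i) :
    ∑ j ∈ Finset.range (b + 1), B j * (Y (j + 1) - Y j) <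
      ∑ i ∈ Finset.range (a + 1), T i * (X (i + 1) - X i) := by
  replace ltX : ∀ i < a + 1, X i < X (i + 1) := fun i hi => ltX i (by omega)
  replace ltY : ∀ i < b + 1, Y i < Y (i + 1) := fun i hi => ltY i (by omega)
  obtain ⟨f, hf⟩ := exists_step_function T ltX
  obtain ⟨g, hg⟩ := exists_step_function B ltY
  rw [← sum_step ltX hf, ← sum_step ltY hg, left, right]
  have h1 := lt_of_step_lt ltY (Nat.succ_pos b) le_rfl
  refine Finset.sum_lt_sum_of_nonempty ?_ ?_
  · rw [Finset.nonempty_Ico]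
    simp at h1
    omega
  · intro c hc
    rw [Finset.mem_Ico] at hc
    obtain ⟨i, hi, h2, h3⟩ := exists_step (X := X) (m := a + 1) (by omega) (by omega : c < _)
    obtain ⟨j, hj, h4, h5⟩ := exists_step hc.1 hc.2
    rw [hf i hi c h2 h3, hg j hj c h4 h5]
    exact sep i (by omega) j (by omega) (by omega) (by omega)

/-- Two staircases that do not meet and of which the first starts above the second stay in that
position. -/
lemma sep_of_disjoint {a b : ℕ} {X T Y B : ℕ → ℤ} (ltX : ∀ i ≤ a, X i < X (i + 1))
    (ltY : ∀ j ≤ b, Y j < Y (j + 1)) (left : X 0 = Y 0)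
    (hT : ∀ i < a, ∀ j ≤ b, Y j ≤ X (i + 1) → X (i + 1) ≤ Y (j + 1) →
      ¬ (min (T i) (T (i + 1)) ≤ B j ∧ B j ≤ max (T i) (T (i + 1))))
    (hB : ∀ j < b, ∀ i ≤ a, X i ≤ Y (j + 1) → Y (j + 1) ≤ X (i + 1) →
      ¬ (min (B j) (B (j + 1)) ≤ T i ∧ T i ≤ max (B j) (B (j + 1))))
    (h0 : B 0 < T 0) :
    ∀ i ≤ a, ∀ j ≤ b, X i ≤ Y (j + 1) → Y j ≤ X (i + 1) → B j < T i := by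
  suffices H : ∀ m i j, i + j = m → i ≤ a → j ≤ b → X i ≤ Y (j + 1) → Y j ≤ X (i + 1) →
      B j < T i from fun i hi j hj => H _ i j rfl hi hj
  intro m
  induction m with
  | zero =>
    intro i j hij _ _ _ _
    obtain ⟨rfl, rfl⟩ : i = 0 ∧ j = 0 := by omega
    exact h0
  | succ m ih =>
    intro i j hij hi hj h1 h2
    by_cases h3 : Y j ≤ X i ∧ 0 < i
    · obtain ⟨i, rfl⟩ : ∃ i', i = i' + 1 := ⟨i - 1, by omega⟩
      have h4 := ih i j (by omega) (by omega) hj ((ltX i (by omega)).le.trans h1) h3.1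
      have h5 := hT i (by omega) j hj h3.1 h1
      omega
    · have h4 : X i ≤ Y j ∧ 0 < j := by
        rcases Nat.eq_zero_or_pos i with rfl | hi0
        · have h5 := lt_of_step_lt (m := b + 1) (fun i hi => ltY i (by omega))
            (by omega : 0 < j) (by omega)
          omega
        · rcases Nat.eq_zero_or_pos j with rfl | hj0
          · have h5 := lt_of_step_lt (m := a + 1) (fun i hi => ltX i (by omega)) hi0 (by omega)
            omega
          · omega
      obtain ⟨j, rfl⟩ : ∃ j', j = j' + 1 := ⟨j - 1, by omega⟩
      have h5 := ih i j (by omega) hi (by omega) h4.1 ((ltY j (by omega)).le.trans h2)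
      have h6 := hB j (by omega) i hi h4.1 h2
      omega

/-- The steps of a height function can be made unit steps of the same directions without lowering
it anywhere and without changing the sum of its end heights and its variation. -/
lemma exists_unit_steps (T : ℕ → ℤ) (a : ℕ) (hT : ∀ i < a, T (i + 1) ≠ T i) :
    ∃ T' : ℕ → ℤ, (∀ i ≤ a, T i ≤ T' i) ∧
      (∀ i < a, T' (i + 1) - T' i = (T (i + 1) - T i).sign) ∧
      T' 0 + T' a + a = T 0 + T a + ∑ i ∈ Finset.range a, |T (i + 1) - T i| := by
  set e : ℕ → ℤ := fun i => (T (i + 1) - T i) - (T (i + 1) - T i).sign with he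
  refine ⟨fun i => T i + ∑ l ∈ Finset.range a, max (e l) 0 - ∑ l ∈ Finset.range i, e l,
    ?_, ?_, ?_⟩
  · intro i hi
    have h1 : ∑ l ∈ Finset.range i, e l ≤ ∑ l ∈ Finset.range i, max (e l) 0 :=
      Finset.sum_le_sum fun _ _ => le_max_left _ _
    have h2 : ∑ l ∈ Finset.range i, max (e l) 0 ≤ ∑ l ∈ Finset.range a, max (e l) 0 :=
      Finset.sum_le_sum_of_subset_of_nonneg (Finset.range_mono hi) fun _ _ _ => le_max_right _ _
    dsimp only
    omega
  · intro i _
    simp only [Finset.sum_range_succ]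
    simp only [he]
    ring
  · have h1 : ∑ i ∈ Finset.range a, |T (i + 1) - T i| =
        ∑ i ∈ Finset.range a, (max (e i) 0 + max (e i) 0 - e i + 1) := by
      refine Finset.sum_congr rfl fun i hi => ?_
      have h2 := hT i (Finset.mem_range.mp hi)
      rcases lt_or_gt_of_ne (sub_ne_zero.mpr h2) with h3 | h3
      · simp only [he, Int.sign_eq_neg_one_of_neg h3, abs_of_neg h3]
        omega
      · simp only [he, Int.sign_eq_one_of_pos h3, abs_of_pos h3]
        omega
    rw [h1]
    simp only [Finset.sum_add_distrib, Finset.sum_sub_distrib, Finset.sum_const,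
      Finset.card_range, Finset.sum_range_zero]
    simp
    ring

lemma abs_sub_le_of_unit_steps {B : ℕ → ℤ} {b : ℕ} (h : ∀ j < b, |B (j + 1) - B j| ≤ 1)
    {i j : ℕ} (hij : i ≤ j) (hj : j ≤ b) : |B j - B i| ≤ (j - i : ℕ) := by
  induction j, hij using Nat.le_induction with
  | base => simp
  | succ j hij ih =>
    have h1 := ih (by omega)
    have h2 := h j (by omega)
    rw [abs_le] at *
    omega

/-- Every separated pair of staircases can be compressed to one with unit steps whose upper
staircase has unit treads, without increasing the length of the boundary. -/
lemma ChainPair.exists_canonical {a b : ℕ} {X T Y B : ℕ → ℤ} (h : ChainPair a b X T Y B)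
    (hba : b ≤ a) :
    ∃ X' T' Y' B' : ℕ → ℤ, ChainPair a b X' T' Y' B' ∧ (∀ i, X' i = i) ∧
      (∀ i < a, T' (i + 1) - T' i = (T (i + 1) - T i).sign) ∧
      (∀ j < b, B' (j + 1) - B' j = (B (j + 1) - B j).sign) ∧
      2 * (a + 1 : ℤ) + a + b + (T' 0 - B' 0) + (T' a - B' b) ≤
        2 * (X (a + 1) - X 0) + ∑ i ∈ Finset.range a, |T (i + 1) - T i| +
          ∑ j ∈ Finset.range b, |B (j + 1) - B j| + (T 0 - B 0) + (T a - B b) := by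
  obtain ⟨T', hT1, hT2, hT3⟩ := exists_unit_steps T a h.neT
  obtain ⟨C, hC1, hC2, hC3⟩ := exists_unit_steps (fun j => - B j) b
    (fun j hj h1 => h.neB j hj (by simpa using h1))
  have hBe : ∀ j, |-B (j + 1) - -B j| = |B (j + 1) - B j| := fun j => by
    rw [← abs_neg]
    congr 1
    ring
  have hC4 : ∀ j < b, - C (j + 1) - - C j = (B (j + 1) - B j).sign := fun j hj => by
    have h1 := hC2 j hj
    simp only [show -B (j + 1) - -B j = -(B (j + 1) - B j) by ring, Int.sign_neg] at h1
    omega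
  simp only [hBe] at hC3
  have mX : ∀ i < a + 1, X i < X (i + 1) := fun i hi => h.ltX i (by omega)
  have mY : ∀ i < b + 1, Y i < Y (i + 1) := fun i hi => h.ltY i (by omega)
  have hleft := h.left
  have hright := h.right
  have hd0 := le_of_step_lt mX (Nat.zero_le (a + 1)) le_rfl
  obtain ⟨d, hd⟩ : ∃ d : ℕ, X (a + 1) = X 0 + (a + 1) + d :=
    ⟨(X (a + 1) - X 0 - (a + 1)).toNat, by omega⟩
  have hsign : ∀ x : ℤ, |x.sign| ≤ 1 := fun x => by
    rcases lt_trichotomy x 0 with h1 | rfl | h1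
    · simp [Int.sign_eq_neg_one_of_neg h1]
    · simp
    · simp [Int.sign_eq_one_of_pos h1]
  have hlip : ∀ j < b, |C (j + 1) - C j| ≤ 1 := fun j hj => by
    rw [hC2 j hj]
    exact hsign _
  have hne : ∀ x : ℤ, x ≠ 0 → x.sign ≠ 0 := fun x hx h1 => hx (Int.sign_eq_zero_iff_zero.mp h1)
  refine ⟨fun i => i, fun i => T' i + d, fun j => max (j : ℤ) (Y j - Y 0 - d), fun j => - C j,
    ⟨?_, ?_, ?_, ?_, ?_, ?_, ?_⟩, fun _ => rfl, ?_, hC4, ?_⟩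
  · intro i _
    push_cast
    omega
  · intro j hj
    have := h.ltY j hj
    push_cast
    omega
  · simp
  · push_cast
    omega
  · intro i hi h1
    have h2 := hT2 i hi
    exact hne _ (sub_ne_zero.mpr (h.neT i hi)) (by omega)
  · intro j hj h1
    have h2 := hC4 j hj
    exact hne _ (sub_ne_zero.mpr (h.neB j hj)) (by omega)
  · intro i hi j hj h1 h2
    push_cast at h1 h2
    suffices H : ∃ j' ≤ b, X i ≤ Y (j' + 1) ∧ Y j' ≤ X (i + 1) ∧ j ≤ j' + d ∧ j' ≤ j + d by
      obtain ⟨j', hj', h3, h4, h5, h6⟩ := H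
      have h7 := h.sep i hi j' hj' h3 h4
      have h8 := hT1 i hi
      have h9 := hC1 j' hj'
      rcases le_total j j' with h10 | h10
      · have := abs_le.mp (abs_sub_le_of_unit_steps hlip h10 hj')
        omega
      · have := abs_le.mp (abs_sub_le_of_unit_steps hlip h10 hj)
        omega
    have x1 := le_of_step_lt mX (Nat.zero_le i) (by omega)
    have x2 := le_of_step_lt mX (show i ≤ a + 1 by omega) le_rfl
    have x3 := le_of_step_lt mX (show i + 1 ≤ a + 1 by omega) le_rfl
    have x4 := h.ltX i hi
    by_cases c1 : X (i + 1) < Y j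
    · obtain ⟨j', hj', h3, h4⟩ := exists_step (X := Y) (m := j) (c := X (i + 1)) (by omega) c1
      have := le_of_step_lt mY (show j' + 1 ≤ j by omega) (by omega)
      exact ⟨j', by omega, by omega, h3, by omega, by omega⟩
    · by_cases c2 : Y (j + 1) < X i
      · have h6 := le_of_step_lt mY (Nat.zero_le (j + 1)) (by omega)
        obtain ⟨j', hj', h3, h4⟩ := exists_step (X := Y) (m := b + 1) (c := X i - 1)
          (by omega) (by omega)
        have h5 : j ≤ j' := by
          by_contra h6
          have := le_of_step_lt mY (show j' + 1 ≤ j + 1 by omega) (by omega)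
          omega
        rcases h5.lt_or_eq with h7 | rfl
        · have := le_of_step_lt mY (show j + 1 ≤ j' by omega) (by omega)
          exact ⟨j', by omega, by omega, by omega, by omega, by omega⟩
        · omega
      · exact ⟨j, hj, by omega, by omega, by omega, by omega⟩
  · intro i hi
    have := hT2 i hi
    dsimp only
    omega
  · dsimp only
    omega

/-! ### Walks along a pair of staircases -/

lemma natCast_eq_of_add_eq {n : ℕ} {k : ZMod n} {s t : ℕ} (hs : s < n) (ht : t < n)
    (h : k + (s : ZMod n) = k + (t : ZMod n)) : s = t := by
  have h1 := (ZMod.natCast_eq_natCast_iff' s t n).mp (add_left_cancel h)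
  rwa [Nat.mod_eq_of_lt hs, Nat.mod_eq_of_lt ht] at h1

lemma exists_natCast_add {n : ℕ} [NeZero n] (k z : ZMod n) : ∃ t < n, z = k + (t : ZMod n) :=
  ⟨(z - k).val, ZMod.val_lt _, by simp⟩

namespace Traces

variable {n : ℕ} {v : ZMod n → ℤ × ℤ} {k : ZMod n} {a b : ℕ} {X T Y B : ℕ → ℤ}

lemma edge_cases [NeZero n] (h : Traces v k a b X T Y B) (z : ZMod n) :
    ∃ t < n, z = k + (t : ZMod n) ∧
      ((∃ j ≤ b, t = 2 * j ∧ v z = (Y j, B j) ∧ v (z + 1) = (Y (j + 1), B j)) ∨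
      (∃ j < b, t = 2 * j + 1 ∧ v z = (Y (j + 1), B j) ∧
        v (z + 1) = (Y (j + 1), B (j + 1))) ∨
      (t = 2 * b + 1 ∧ v z = (Y (b + 1), B b) ∧ v (z + 1) = (X (a + 1), T a)) ∨
      (∃ i ≤ a, t + 2 * i = 2 * a + 2 * b + 2 ∧ v z = (X (i + 1), T i) ∧
        v (z + 1) = (X i, T i)) ∨
      (∃ i < a, t + 2 * i = 2 * a + 2 * b + 1 ∧ v z = (X (i + 1), T (i + 1)) ∧
        v (z + 1) = (X (i + 1), T i)) ∨
      (t = 2 * a + 2 * b + 3 ∧ v z = (X 0, T 0) ∧ v (z + 1) = (Y 0, B 0))) := by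
  obtain ⟨t, ht, rfl⟩ := exists_natCast_add k z
  have hn := h.len
  refine ⟨t, ht, rfl, ?_⟩
  have hs : k + (t : ZMod n) + 1 = k + ((t + 1 : ℕ) : ZMod n) := by
    push_cast
    ring
  rw [hs]
  rcases Nat.even_or_odd' t with ⟨j, rfl | rfl⟩
  · by_cases hj : j ≤ b
    · exact Or.inl ⟨j, hj, rfl, h.lower_left j hj, h.lower_right j hj⟩
    · obtain ⟨i, hi⟩ : ∃ i, i + j = a + b + 1 := ⟨a + b + 1 - j, by omega⟩
      have h1 := h.upper_right i (by omega)
      have h2 := h.upper_left i (by omega)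
      rw [show 2 * a + 2 * b + 2 - 2 * i = 2 * j by omega] at h1
      rw [show 2 * a + 2 * b + 3 - 2 * i = 2 * j + 1 by omega] at h2
      exact Or.inr (Or.inr (Or.inr (Or.inl ⟨i, by omega, by omega, h1, h2⟩)))
  · rcases lt_trichotomy j b with hj | rfl | hj
    · exact Or.inr (Or.inl ⟨j, hj, rfl, h.lower_right j hj.le, h.lower_left (j + 1) hj⟩)
    · have h1 := h.upper_right a le_rfl
      rw [show 2 * a + 2 * j + 2 - 2 * a = 2 * j + 1 + 1 by omega] at h1
      exact Or.inr (Or.inr (Or.inl ⟨rfl, h.lower_right j le_rfl, h1⟩))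
    · by_cases hj2 : j = a + b + 1
      · subst hj2
        have h1 := h.upper_left 0 (Nat.zero_le _)
        have h2 := h.lower_left 0 (Nat.zero_le _)
        rw [show 2 * a + 2 * b + 3 - 2 * 0 = 2 * (a + b + 1) + 1 by omega] at h1
        rw [show (((2 * (a + b + 1) + 1 + 1 : ℕ)) : ZMod n) = ((2 * 0 : ℕ) : ZMod n) by
          rw [show 2 * (a + b + 1) + 1 + 1 = n by omega]
          simp]
        exact Or.inr (Or.inr (Or.inr (Or.inr (Or.inr ⟨by omega, h1, h2⟩))))
      · obtain ⟨i, hi⟩ : ∃ i, i + j = a + b := ⟨a + b - j, by omega⟩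
        have h1 := h.upper_left (i + 1) (by omega)
        have h2 := h.upper_right i (by omega)
        rw [show 2 * a + 2 * b + 3 - 2 * (i + 1) = 2 * j + 1 by omega] at h1
        rw [show 2 * a + 2 * b + 2 - 2 * i = 2 * j + 1 + 1 by omega] at h2
        exact Or.inr (Or.inr (Or.inr (Or.inr (Or.inl ⟨i, by omega, by omega, h1, h2⟩))))

/-- Edges at even distance from `k` are horizontal and the others are vertical. -/
lemma parity [NeZero n] (h : Traces v k a b X T Y B) (hc : ChainPair a b X T Y B) (z : ZMod n) :
    ∃ t < n, z = k + (t : ZMod n) ∧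
      ((t % 2 = 0 ∧ (v (z + 1)).2 = (v z).2 ∧ (v (z + 1)).1 ≠ (v z).1) ∨
      (t % 2 = 1 ∧ (v (z + 1)).1 = (v z).1 ∧ (v (z + 1)).2 ≠ (v z).2)) := by
  obtain ⟨t, ht, hz, h1⟩ := h.edge_cases z
  refine ⟨t, ht, hz, ?_⟩
  have hl := hc.left
  have hr := hc.right
  have ha := hc.ltX a le_rfl
  have hb := hc.ltY b le_rfl
  have h0 := hc.ltX 0 (Nat.zero_le _)
  have h0' := hc.ltY 0 (Nat.zero_le _)
  have hsl := hc.sep_left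
  have hsr := hc.sep_right
  rcases h1 with ⟨j, hj, h2, h3, h4⟩ | ⟨j, hj, h2, h3, h4⟩ | ⟨h2, h3, h4⟩ | ⟨j, hj, h2, h3, h4⟩ |
    ⟨j, hj, h2, h3, h4⟩ | ⟨h2, h3, h4⟩ <;> rw [h3, h4]
  · exact Or.inl ⟨by omega, rfl, (hc.ltY j hj).ne'⟩
  · exact Or.inr ⟨by omega, rfl, hc.neB j hj⟩
  · exact Or.inr ⟨by omega, hr, hsr.ne'⟩
  · exact Or.inl ⟨by omega, rfl, (hc.ltX j hj).ne⟩
  · exact Or.inr ⟨by omega, rfl, (hc.neT j hj).symm⟩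
  · exact Or.inr ⟨by omega, hl.symm, hsl.ne⟩

set_option maxHeartbeats 1000000 in
lemma edges_meet [NeZero n] (h : Traces v k a b X T Y B) (hc : ChainPair a b X T Y B) {s t : ℕ}
    (hst : s < t) (htn : t < n) {p : ℤ × ℤ}
    (hs : onSeg (v (k + (s : ZMod n))) (v (k + (s : ZMod n) + 1)) p)
    (ht : onSeg (v (k + (t : ZMod n))) (v (k + (t : ZMod n) + 1)) p) :
    (t = s + 1 ∧ p = v (k + (t : ZMod n))) ∨ (s = 0 ∧ t + 1 = n ∧ p = v (k + (s : ZMod n))) := by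
  obtain ⟨s', hs', hs1, hs2⟩ := h.edge_cases (k + (s : ZMod n))
  obtain rfl := natCast_eq_of_add_eq (by omega) hs' hs1
  obtain ⟨t', ht', ht1, ht2⟩ := h.edge_cases (k + (t : ZMod n))
  obtain rfl := natCast_eq_of_add_eq (by omega) ht' ht1
  clear hs1 ht1 hs' ht'
  have hn := h.len
  have hl := hc.left
  have hr := hc.right
  have mX : ∀ i < a + 1, X i < X (i + 1) := fun i hi => hc.ltX i (by omega)
  have mY : ∀ i < b + 1, Y i < Y (i + 1) := fun i hi => hc.ltY i (by omega)
  have uX : ∀ i ≤ a + 1, ∀ j ≤ a + 1, i ≤ j → X i + (j - i : ℕ) ≤ X j :=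
    fun i _ j hj hij => le_of_step_lt mX hij hj
  have uY : ∀ i ≤ b + 1, ∀ j ≤ b + 1, i ≤ j → Y i + (j - i : ℕ) ≤ Y j :=
    fun i _ j hj hij => le_of_step_lt mY hij hj
  have ha := hc.ltX a le_rfl
  have hb := hc.ltY b le_rfl
  have h0 := hc.ltX 0 (Nat.zero_le _)
  have h0' := hc.ltY 0 (Nat.zero_le _)
  have hsl := hc.sep_left
  have hsr := hc.sep_right
  obtain ⟨x, y⟩ := p
  rcases hs2 with ⟨j, hj, h2, h3, h4⟩ | ⟨j, hj, h2, h3, h4⟩ | ⟨h2, h3, h4⟩ | ⟨i, hi, h2, h3, h4⟩ |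
    ⟨i, hi, h2, h3, h4⟩ | ⟨h2, h3, h4⟩ <;>
  rcases ht2 with ⟨j', hj', h5, h6, h7⟩ | ⟨j', hj', h5, h6, h7⟩ | ⟨h5, h6, h7⟩ |
    ⟨i', hi', h5, h6, h7⟩ | ⟨i', hi', h5, h6, h7⟩ | ⟨h5, h6, h7⟩ <;>
  (first | (exfalso; omega) | skip) <;> rw [h3, h4] at hs <;> rw [h6, h7] at ht <;>
  rw [h3, h6] <;> simp only [onSeg, Prod.mk.injEq] at hs ht ⊢ <;> clear h3 h4 h6 h7
  · have := hc.ltY j hj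
    have := hc.ltY j' (by omega)
    have := uY (j + 1) (by omega) j' (by omega) (by omega)
    rcases (show j' = j + 1 ∨ j + 1 < j' by omega) with rfl | _
    · have := hc.neB j (by omega)
      omega
    · omega
  · have := hc.ltY j hj
    have := hc.ltY j' (by omega)
    rcases (show j' = j ∨ j < j' by omega) with rfl | _
    · omega
    · have := uY (j + 1) (by omega) j' (by omega) (by omega)
      omega
  · have := hc.ltY j hj
    rcases (show j = b ∨ j < b by omega) with rfl | _
    · omega
    · have := uY (j + 1) (by omega) b (by omega) (by omega)
      omega
  · have := hc.sep i' hi' j hj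
    have := hc.ltX i' hi'
    have := hc.ltY j hj
    omega
  · have := hc.sep i' (by omega) j hj
    have := hc.sep (i' + 1) (by omega) j hj
    have := hc.ltX i' (by omega)
    have := hc.ltX (i' + 1) (by omega)
    have := hc.ltY j hj
    omega
  · have := hc.ltY j hj
    rcases (show j = 0 ∨ 0 < j by omega) with rfl | _
    · omega
    · have := uY 0 (by omega) j (by omega) (by omega)
      omega
  · have := hc.ltY j' (by omega)
    rcases (show j' = j + 1 ∨ j + 1 < j' by omega) with rfl | _
    · omega
    · have := uY (j + 1) (by omega) j' (by omega) (by omega)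
      omega
  · have := uY (j + 1) (by omega) (j' + 1) (by omega) (by omega)
    omega
  · have := uY (j + 1) (by omega) (b + 1) (by omega) (by omega)
    omega
  · have := hc.sep i' hi' j (by omega)
    have := hc.sep i' hi' (j + 1) (by omega)
    have := hc.ltX i' hi'
    have := hc.ltY j (by omega)
    have := hc.ltY (j + 1) (by omega)
    omega
  · have := hc.sep i' (by omega) j (by omega)
    have := hc.sep (i' + 1) (by omega) j (by omega)
    have := hc.sep i' (by omega) (j + 1) (by omega)
    have := hc.sep (i' + 1) (by omega) (j + 1) (by omega)
    have := hc.ltX i' (by omega)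
    have := hc.ltX (i' + 1) (by omega)
    have := hc.ltY j (by omega)
    have := hc.ltY (j + 1) (by omega)
    omega
  · have := uY 0 (by omega) (j + 1) (by omega) (by omega)
    omega
  · have := hc.ltX i' (by omega)
    rcases (show i' = a ∨ i' < a by omega) with rfl | _
    · omega
    · have := uX (i' + 1) (by omega) (a + 1) (by omega) (by omega)
      omega
  · have := uX (i' + 1) (by omega) (a + 1) (by omega) (by omega)
    omega
  · have := uX 0 (by omega) (a + 1) (by omega) (by omega)
    omega
  · have := uX (i' + 1) (by omega) i (by omega) (by omega)
    rcases (show i = i' + 1 ∨ i' + 1 < i by omega) with rfl | _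
    · have := hc.neT i' (by omega)
      omega
    · have := hc.ltX i (by omega)
      have := hc.ltX i' (by omega)
      omega
  · have := hc.ltX i (by omega)
    rcases (show i = i' + 1 ∨ i' + 1 < i by omega) with rfl | _
    · omega
    · have := uX (i' + 1) (by omega) i (by omega) (by omega)
      omega
  · have := hc.ltX i (by omega)
    rcases (show i = 0 ∨ 0 < i by omega) with rfl | _
    · omega
    · have := uX 0 (by omega) i (by omega) (by omega)
      omega
  · have := hc.ltX i' (by omega)
    rcases (show i = i' ∨ i' < i by omega) with rfl | _
    · omega
    · have := uX (i' + 1) (by omega) (i + 1) (by omega) (by omega)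
      omega
  · have := uX (i' + 1) (by omega) (i + 1) (by omega) (by omega)
    omega
  · have := uX 0 (by omega) (i + 1) (by omega) (by omega)
    omega

end Traces

/-- Every separated pair of staircases bounds a simple rectilinear polygon. -/
lemma exists_rectPolygon {n : ℕ} [NeZero n] (k : ZMod n) {a b : ℕ} {X T Y B : ℕ → ℤ}
    (hn : n = 2 * a + 2 * b + 4) (hc : ChainPair a b X T Y B) :
    ∃ P : RectPolygon n, Traces P.v k a b X T Y B := by
  let w : ℕ → ℤ × ℤ := fun t => if t < 2 * b + 2 then (Y ((t + 1) / 2), B (t / 2)) else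
    (X ((2 * a + 2 * b + 4 - t) / 2), T ((2 * a + 2 * b + 3 - t) / 2))
  let v : ZMod n → ℤ × ℤ := fun z => w (z - k).val
  have hv : ∀ t < n, v (k + (t : ZMod n)) = w t := fun t ht => by
    simp only [v, add_sub_cancel_left, ZMod.val_natCast_of_lt ht]
  have h : Traces v k a b X T Y B := by
    refine ⟨hn, fun j hj => ?_, fun j hj => ?_, fun i hi => ?_, fun i hi => ?_⟩ <;>
      rw [hv _ (by omega)] <;> simp only [w]
    · rw [if_pos (by omega), show (2 * j + 1) / 2 = j by omega, show 2 * j / 2 = j by omega]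
    · rw [if_pos (by omega), show (2 * j + 1 + 1) / 2 = j + 1 by omega,
        show (2 * j + 1) / 2 = j by omega]
    · rw [if_neg (by omega),
        show (2 * a + 2 * b + 4 - (2 * a + 2 * b + 3 - 2 * i)) / 2 = i by omega,
        show (2 * a + 2 * b + 3 - (2 * a + 2 * b + 3 - 2 * i)) / 2 = i by omega]
    · rw [if_neg (by omega),
        show (2 * a + 2 * b + 4 - (2 * a + 2 * b + 2 - 2 * i)) / 2 = i + 1 by omega,
        show (2 * a + 2 * b + 3 - (2 * a + 2 * b + 2 - 2 * i)) / 2 = i by omega]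
  refine ⟨⟨v, fun z => ?_, fun z => ?_, fun z => ?_, fun z z' hne p hz hz' => ?_⟩, h⟩
  · obtain ⟨t, -, -, ⟨-, -, h1⟩ | ⟨-, -, h1⟩⟩ := h.parity hc z
    · exact fun h2 => h1 (by rw [h2])
    · exact fun h2 => h1 (by rw [h2])
  · obtain ⟨t, -, -, ⟨-, h1, -⟩ | ⟨-, h1, -⟩⟩ := h.parity hc z
    · exact Or.inr h1
    · exact Or.inl h1
  · obtain ⟨t, ht, hz, h1⟩ := h.parity hc z
    obtain ⟨s, hs, hz', h2⟩ := h.parity hc (z + 1)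
    rw [show z + 1 + 1 = z + 2 by ring] at h2
    have hst : s % 2 ≠ t % 2 := by
      by_cases h3 : t + 1 < n
      · have : s = t + 1 := natCast_eq_of_add_eq (k := k) hs h3 (by
          rw [← hz', hz]
          push_cast
          ring)
        omega
      · have : s = 0 := natCast_eq_of_add_eq (k := k) hs (by omega) (by
          rw [← hz', hz, show k + (t : ZMod n) + 1 = k + ((t + 1 : ℕ) : ZMod n) by
            push_cast
            ring, show t + 1 = n by omega]
          simp)
        omega
    rcases h1 with ⟨p1, -, p2⟩ | ⟨p1, p2, -⟩ <;> rcases h2 with ⟨q1, q2, -⟩ | ⟨q1, -, q2⟩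
    · omega
    · exact iff_of_false p2 q2
    · exact iff_of_true p2 q2
    · omega
  · obtain ⟨s, hs, rfl⟩ := exists_natCast_add k z
    obtain ⟨t, ht, rfl⟩ := exists_natCast_add k z'
    have hc1 : ∀ m : ℕ, k + ((m + 1 : ℕ) : ZMod n) = k + (m : ZMod n) + 1 := fun m => by
      push_cast
      ring
    have hc2 : ∀ m : ℕ, m + 1 = n → k + ((0 : ℕ) : ZMod n) = k + (m : ZMod n) + 1 := fun m hm => by
      rw [← hc1, hm]
      simp
    rcases lt_trichotomy s t with h1 | rfl | h1
    · rcases h.edges_meet hc h1 ht hz hz' with ⟨rfl, h2⟩ | ⟨rfl, h3, h2⟩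
      · exact Or.inl ⟨hc1 _, h2⟩
      · exact Or.inr ⟨hc2 _ h3, h2⟩
    · exact absurd rfl hne
    · rcases h.edges_meet hc h1 hs hz' hz with ⟨rfl, h2⟩ | ⟨rfl, h3, h2⟩
      · exact Or.inr ⟨hc1 _, h2⟩
      · exact Or.inl ⟨hc2 _ h3, h2⟩

lemma sum_zmod_eq_sum_range {n : ℕ} [NeZero n] (k : ZMod n) (f : ZMod n → ℤ) :
    ∑ z, f z = ∑ t ∈ Finset.range n, f (k + (t : ZMod n)) := by
  refine Finset.sum_nbij' (fun z => (z - k).val) (fun t => k + (t : ZMod n)) ?_ ?_ ?_ ?_ ?_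
  · exact fun z _ => Finset.mem_range.mpr (ZMod.val_lt _)
  · simp
  · simp
  · intro t ht
    simp [ZMod.val_natCast_of_lt (Finset.mem_range.mp ht)]
  · simp

lemma sum_range_two_mul (g : ℕ → ℤ) (m : ℕ) :
    ∑ t ∈ Finset.range (2 * m), g t = ∑ j ∈ Finset.range m, (g (2 * j) + g (2 * j + 1)) := by
  induction m with
  | zero => simp
  | succ m ih =>
    rw [show 2 * (m + 1) = 2 * m + 1 + 1 by ring, Finset.sum_range_succ, Finset.sum_range_succ,
      ih, Finset.sum_range_succ]
    ring

/-- A sum over the edges, split into the edges of the lower staircase, the right edge, the edges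
of the upper staircase and the left edge. -/
lemma sum_edges {n : ℕ} [NeZero n] (k : ZMod n) {a b : ℕ} (hn : n = 2 * a + 2 * b + 4)
    (f : ZMod n → ℤ) :
    ∑ z, f z = ∑ j ∈ Finset.range (b + 1), f (k + ((2 * j : ℕ) : ZMod n)) +
      ∑ j ∈ Finset.range b, f (k + ((2 * j + 1 : ℕ) : ZMod n)) +
      f (k + ((2 * b + 1 : ℕ) : ZMod n)) +
      ∑ i ∈ Finset.range (a + 1), f (k + ((2 * a + 2 * b + 2 - 2 * i : ℕ) : ZMod n)) +
      ∑ i ∈ Finset.range a, f (k + ((2 * a + 2 * b + 1 - 2 * i : ℕ) : ZMod n)) +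
      f (k + ((2 * a + 2 * b + 3 : ℕ) : ZMod n)) := by
  set g : ℕ → ℤ := fun t => f (k + (t : ZMod n)) with hg
  have h1 : ∑ z, f z = ∑ j ∈ Finset.range (b + 1), (g (2 * j) + g (2 * j + 1)) +
      ∑ i ∈ Finset.range (a + 1), (g (2 * (b + 1 + i)) + g (2 * (b + 1 + i) + 1)) := by
    rw [← Finset.sum_range_add (fun j => g (2 * j) + g (2 * j + 1)), ← sum_range_two_mul,
      sum_zmod_eq_sum_range k, show 2 * (b + 1 + (a + 1)) = n by omega]
  have h2 : ∑ i ∈ Finset.range (a + 1), g (2 * (b + 1 + i)) =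
      ∑ i ∈ Finset.range (a + 1), g (2 * a + 2 * b + 2 - 2 * i) := by
    rw [← Finset.sum_range_reflect]
    refine Finset.sum_congr rfl fun i hi => ?_
    rw [Finset.mem_range] at hi
    congr 1
    omega
  have h3 : ∑ i ∈ Finset.range a, g (2 * (b + 1 + i) + 1) =
      ∑ i ∈ Finset.range a, g (2 * a + 2 * b + 1 - 2 * i) := by
    rw [← Finset.sum_range_reflect]
    refine Finset.sum_congr rfl fun i hi => ?_
    rw [Finset.mem_range] at hi
    congr 1
    omega
  rw [h1, Finset.sum_add_distrib, Finset.sum_add_distrib, h2,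
    Finset.sum_range_succ (fun j => g (2 * j + 1)),
    Finset.sum_range_succ (fun i => g (2 * (b + 1 + i) + 1)), h3,
    show 2 * (b + 1 + a) + 1 = 2 * a + 2 * b + 3 by omega]
  ring

namespace Traces

variable {n : ℕ} {P : RectPolygon n} {k : ZMod n} {a b : ℕ} {X T Y B : ℕ → ℤ}

lemma succ_natCast (k : ZMod n) (t : ℕ) :
    k + (t : ZMod n) + 1 = k + ((t + 1 : ℕ) : ZMod n) := by
  push_cast
  ring

lemma lower_horiz (h : Traces P.v k a b X T Y B) {j : ℕ} (hj : j ≤ b) :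
    P.sx (k + ((2 * j : ℕ) : ZMod n)) = Y (j + 1) - Y j ∧
    P.sy (k + ((2 * j : ℕ) : ZMod n)) = 0 := by
  simp [RectPolygon.sx, RectPolygon.sy, succ_natCast, -Nat.cast_add, -Nat.cast_mul,
    h.lower_left j hj, h.lower_right j hj]

lemma lower_vert (h : Traces P.v k a b X T Y B) {j : ℕ} (hj : j < b) :
    P.sx (k + ((2 * j + 1 : ℕ) : ZMod n)) = 0 ∧
    P.sy (k + ((2 * j + 1 : ℕ) : ZMod n)) = B (j + 1) - B j := by
  have h1 := h.lower_left (j + 1) hj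
  rw [show 2 * (j + 1) = 2 * j + 1 + 1 by ring] at h1
  simp [RectPolygon.sx, RectPolygon.sy, succ_natCast, -Nat.cast_add, -Nat.cast_mul,
    h.lower_right j hj.le, h1]

lemma right_vert (h : Traces P.v k a b X T Y B) (hr : X (a + 1) = Y (b + 1)) :
    P.sx (k + ((2 * b + 1 : ℕ) : ZMod n)) = 0 ∧
    P.sy (k + ((2 * b + 1 : ℕ) : ZMod n)) = T a - B b := by
  have h1 := h.upper_right a le_rfl
  rw [show 2 * a + 2 * b + 2 - 2 * a = 2 * b + 1 + 1 by omega] at h1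
  simp [RectPolygon.sx, RectPolygon.sy, succ_natCast, -Nat.cast_add, -Nat.cast_mul,
    h.lower_right b le_rfl, h1, hr]

lemma upper_horiz (h : Traces P.v k a b X T Y B) {i : ℕ} (hi : i ≤ a) :
    P.sx (k + ((2 * a + 2 * b + 2 - 2 * i : ℕ) : ZMod n)) = X i - X (i + 1) ∧
    P.sy (k + ((2 * a + 2 * b + 2 - 2 * i : ℕ) : ZMod n)) = 0 := by
  have h1 := h.upper_left i hi
  rw [show 2 * a + 2 * b + 3 - 2 * i = 2 * a + 2 * b + 2 - 2 * i + 1 by omega] at h1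
  simp [RectPolygon.sx, RectPolygon.sy, succ_natCast, -Nat.cast_add, -Nat.cast_mul,
    h.upper_right i hi, h1]

lemma upper_vert (h : Traces P.v k a b X T Y B) {i : ℕ} (hi : i < a) :
    P.sx (k + ((2 * a + 2 * b + 1 - 2 * i : ℕ) : ZMod n)) = 0 ∧
    P.sy (k + ((2 * a + 2 * b + 1 - 2 * i : ℕ) : ZMod n)) = T i - T (i + 1) := by
  have h1 := h.upper_left (i + 1) hi
  have h2 := h.upper_right i hi.le
  rw [show 2 * a + 2 * b + 3 - 2 * (i + 1) = 2 * a + 2 * b + 1 - 2 * i by omega] at h1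
  rw [show 2 * a + 2 * b + 2 - 2 * i = 2 * a + 2 * b + 1 - 2 * i + 1 by omega] at h2
  simp [RectPolygon.sx, RectPolygon.sy, succ_natCast, -Nat.cast_add, -Nat.cast_mul, h1, h2]

lemma left_vert (h : Traces P.v k a b X T Y B) (hl : X 0 = Y 0) :
    P.sx (k + ((2 * a + 2 * b + 3 : ℕ) : ZMod n)) = 0 ∧
    P.sy (k + ((2 * a + 2 * b + 3 : ℕ) : ZMod n)) = B 0 - T 0 := by
  have h1 := h.upper_left 0 (Nat.zero_le _)
  have h2 := h.lower_left 0 (Nat.zero_le _)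
  rw [show 2 * a + 2 * b + 3 - 2 * 0 = 2 * a + 2 * b + 3 by omega] at h1
  rw [show k + ((2 * 0 : ℕ) : ZMod n) = k + ((2 * a + 2 * b + 3 + 1 : ℕ) : ZMod n) by
    rw [← h.len]
    simp] at h2
  simp [RectPolygon.sx, RectPolygon.sy, succ_natCast, -Nat.cast_add, -Nat.cast_mul, h1, h2, hl]

/-- The shoelace sum is twice the area between the staircases. -/
lemma shoelace [NeZero n] (h : Traces P.v k a b X T Y B) (hl : X 0 = Y 0)
    (hr : X (a + 1) = Y (b + 1)) :
    ∑ z, cross (P.v z) (P.v (z + 1)) =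
      2 * (∑ i ∈ Finset.range (a + 1), T i * (X (i + 1) - X i) -
        ∑ j ∈ Finset.range (b + 1), B j * (Y (j + 1) - Y j)) := by
  have h1 : ∑ z, (P.v (z + 1)).1 * (P.v (z + 1)).2 = ∑ z, (P.v z).1 * (P.v z).2 :=
    Equiv.sum_comp (Equiv.addRight (1 : ZMod n)) fun z => (P.v z).1 * (P.v z).2
  have h2 : ∑ z, cross (P.v z) (P.v (z + 1)) =
      ∑ z, -(P.sx z * (2 * (P.v z).2 + P.sy z)) := by
    rw [← sub_eq_zero, ← Finset.sum_sub_distrib]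
    rw [← sub_eq_zero, ← Finset.sum_sub_distrib] at h1
    rw [← h1]
    refine Finset.sum_congr rfl fun z _ => ?_
    simp only [cross, RectPolygon.sx, RectPolygon.sy]
    ring
  rw [h2, sum_edges k h.len, (h.right_vert hr).1, (h.left_vert hl).1,
    Finset.sum_congr rfl (g := fun j => -2 * (B j * (Y (j + 1) - Y j))),
    Finset.sum_congr (s₁ := Finset.range b) rfl (g := fun j => 0),
    Finset.sum_congr (s₁ := Finset.range (a + 1)) rfl (g := fun i => 2 * (T i * (X (i + 1) - X i))),
    Finset.sum_congr (s₁ := Finset.range a) rfl (g := fun j => 0), ← Finset.mul_sum,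
    ← Finset.mul_sum]
  · simp
    ring
  · intro i hi
    rw [(h.upper_vert (Finset.mem_range.mp hi)).1]
    simp
  · intro i hi
    have hi' := Nat.lt_succ_iff.mp (Finset.mem_range.mp hi)
    rw [(h.upper_horiz hi').1, (h.upper_horiz hi').2, h.upper_right i hi']
    simp only
    ring
  · intro j hj
    rw [(h.lower_vert (Finset.mem_range.mp hj)).1]
    simp
  · intro j hj
    have hj' := Nat.lt_succ_iff.mp (Finset.mem_range.mp hj)
    rw [(h.lower_horiz hj').1, (h.lower_horiz hj').2, h.lower_left j hj']
    simp only
    ring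

lemma ccw [NeZero n] (h : Traces P.v k a b X T Y B) (hc : ChainPair a b X T Y B) : P.ccw := by
  have h1 := area_pos_of_sep hc.ltX hc.ltY hc.left hc.right hc.sep
  rw [RectPolygon.ccw, h.shoelace hc.left hc.right]
  omega

lemma perimeter_eq [NeZero n] (h : Traces P.v k a b X T Y B) (hc : ChainPair a b X T Y B) :
    P.perimeter = 2 * (X (a + 1) - X 0) + ∑ i ∈ Finset.range a, |T (i + 1) - T i| +
      ∑ j ∈ Finset.range b, |B (j + 1) - B j| + (T 0 - B 0) + (T a - B b) := by
  have hl := hc.left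
  have hr := hc.right
  have h0 := hc.ltX 0 (Nat.zero_le _)
  have h0' := hc.ltY 0 (Nat.zero_le _)
  have ha := hc.ltX a le_rfl
  have hb := hc.ltY b le_rfl
  have hsl := hc.sep_left
  have hsr := hc.sep_right
  have he : ∀ z, P.elen z = |P.sx z| + |P.sy z| := fun _ => rfl
  simp only [RectPolygon.perimeter, he]
  rw [sum_edges k h.len, (h.right_vert hr).1, (h.left_vert hl).1, (h.right_vert hr).2,
    (h.left_vert hl).2,
    Finset.sum_congr rfl (g := fun j => Y (j + 1) - Y j),
    Finset.sum_congr (s₁ := Finset.range b) rfl (g := fun j => |B (j + 1) - B j|),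
    Finset.sum_congr (s₁ := Finset.range (a + 1)) rfl (g := fun i => X (i + 1) - X i),
    Finset.sum_congr (s₁ := Finset.range a) rfl (g := fun i => |T (i + 1) - T i|),
    Finset.sum_range_sub, Finset.sum_range_sub, abs_of_pos (show 0 < T a - B b by omega),
    abs_of_neg (show B 0 - T 0 < 0 by omega)]
  · simp
    omega
  · intro i hi
    rw [(h.upper_vert (Finset.mem_range.mp hi)).1, (h.upper_vert (Finset.mem_range.mp hi)).2,
      abs_sub_comm]
    simp
  · intro i hi
    have hi' := Nat.lt_succ_iff.mp (Finset.mem_range.mp hi)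
    have := hc.ltX i hi'
    rw [(h.upper_horiz hi').1, (h.upper_horiz hi').2, abs_of_neg (by omega)]
    simp
  · intro j hj
    rw [(h.lower_vert (Finset.mem_range.mp hj)).1, (h.lower_vert (Finset.mem_range.mp hj)).2]
    simp
  · intro j hj
    have hj' := Nat.lt_succ_iff.mp (Finset.mem_range.mp hj)
    have := hc.ltY j hj'
    rw [(h.lower_horiz hj').1, (h.lower_horiz hj').2, abs_of_pos (by omega)]
    simp

end Traces

namespace RectPolygon

variable {n : ℕ}

lemma horiz_iff_sy (P : RectPolygon n) (z : ZMod n) : P.horiz z ↔ P.sy z = 0 :=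
  sub_eq_zero.symm

lemma vert_iff_sx (P : RectPolygon n) (z : ZMod n) : P.vert z ↔ P.sx z = 0 :=
  sub_eq_zero.symm

lemma horiz_iff_not_vert (P : RectPolygon n) (z : ZMod n) : P.horiz z ↔ ¬ P.vert z := by
  have h1 := P.nondeg z
  have h2 := P.axis z
  rw [horiz, vert]
  constructor
  · exact fun h3 h4 => h1 (Prod.ext h4 h3)
  · exact fun h3 => h2.resolve_left h3

lemma horiz_succ_iff (P : RectPolygon n) (z : ZMod n) : P.horiz (z + 1) ↔ ¬ P.horiz z := by
  have h1 := P.alt z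
  rw [show z + 2 = z + 1 + 1 by ring] at h1
  rw [P.horiz_iff_not_vert z, not_not]
  exact h1.symm

lemma horiz_add_iff (P : RectPolygon n) {z : ZMod n} (hz : P.horiz z) (t : ℕ) :
    P.horiz (z + (t : ZMod n)) ↔ Even t := by
  induction t with
  | zero => simpa using hz
  | succ t ih => rw [← Traces.succ_natCast, horiz_succ_iff, ih, Nat.even_add_one]

lemma sx_ne_zero (P : RectPolygon n) {z : ZMod n} (hz : P.horiz z) : P.sx z ≠ 0 := by
  rw [horiz_iff_not_vert, vert_iff_sx] at hz
  exact hz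

lemma cross_eq (P : RectPolygon n) (z : ZMod n) :
    cross (P.dvec (z - 1)) (P.dvec z) = P.sx (z - 1) * P.sy z - P.sy (z - 1) * P.sx z := rfl

lemma sign_cross (P : RectPolygon n) (z : ZMod n) :
    (cross (P.dvec (z - 1)) (P.dvec z)).sign =
      (P.sx (z - 1)).sign * (P.sy z).sign - (P.sy (z - 1)).sign * (P.sx z).sign := by
  rw [cross_eq]
  rcases P.axis (z - 1) with h | h
  · have h1 : P.sx (z - 1) = 0 := (P.vert_iff_sx _).mp h
    simp [h1, Int.sign_mul]
  · have h1 : P.sy (z - 1) = 0 := (P.horiz_iff_sy _).mp h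
    simp [h1, Int.sign_mul]

/-- Polygons whose corresponding edges point in the same directions. -/
def SameDirections (P Q : RectPolygon n) : Prop :=
  ∀ z, (P.sx z).sign = (Q.sx z).sign ∧ (P.sy z).sign = (Q.sy z).sign

lemma SameDirections.isXMonotone {P Q : RectPolygon n} (h : SameDirections P Q)
    (hP : P.IsXMonotone) : Q.IsXMonotone := by
  rw [IsXMonotone] at hP ⊢
  rw [← hP]
  congr 1
  ext z
  simp only [Set.mem_ofPred_eq, horiz_iff_sy, ← Int.sign_eq_neg_one_iff_neg, Int.sign_mul, (h z).1,
    (h (z + 2)).1]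
  rw [← Int.sign_eq_zero_iff_zero, ← (h z).2, Int.sign_eq_zero_iff_zero]

lemma SameDirections.convexAt_iff {P Q : RectPolygon n} (h : SameDirections P Q) (z : ZMod n) :
    P.convexAt z ↔ Q.convexAt z := by
  simp only [convexAt, ← Int.sign_eq_one_iff_pos, sign_cross, (h z).1, (h z).2, (h (z - 1)).1,
    (h (z - 1)).2]

lemma SameDirections.reflexAt_iff {P Q : RectPolygon n} (h : SameDirections P Q) (z : ZMod n) :
    P.reflexAt z ↔ Q.reflexAt z := by
  simp only [reflexAt, ← Int.sign_eq_neg_one_iff_neg, sign_cross, (h z).1, (h z).2, (h (z - 1)).1,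
    (h (z - 1)).2]

/-- The image of a polygon under the point reflection in the origin. -/
def neg (P : RectPolygon n) : RectPolygon n where
  v z := -P.v z
  nondeg z h := P.nondeg z (neg_injective h)
  axis z := by simpa using P.axis z
  alt z := by simpa using P.alt z
  simple z z' hne p hz hz' := by
    have H : ∀ q r : ℤ × ℤ, onSeg (-q) (-r) p → onSeg q r (-p) := fun q r h => by
      simp only [onSeg, Prod.fst_neg, Prod.snd_neg] at h ⊢
      omega
    rcases P.simple z z' hne (-p) (H _ _ hz) (H _ _ hz') with ⟨h1, h2⟩ | ⟨h1, h2⟩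
    · exact Or.inl ⟨h1, by rw [← h2, neg_neg]⟩
    · exact Or.inr ⟨h1, by rw [← h2, neg_neg]⟩

lemma neg_sx (P : RectPolygon n) (z : ZMod n) : P.neg.sx z = -P.sx z := by
  simp only [sx, neg, Prod.fst_neg]
  ring

lemma neg_sy (P : RectPolygon n) (z : ZMod n) : P.neg.sy z = -P.sy z := by
  simp only [sy, neg, Prod.snd_neg]
  ring

lemma neg_cross (P : RectPolygon n) (z : ZMod n) :
    cross (P.neg.dvec (z - 1)) (P.neg.dvec z) = cross (P.dvec (z - 1)) (P.dvec z) := by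
  simp only [cross_eq, neg_sx, neg_sy]
  ring

lemma neg_isXMonotone {P : RectPolygon n} (h : P.IsXMonotone) : P.neg.IsXMonotone := by
  rw [IsXMonotone] at h ⊢
  simpa only [horiz_iff_sy, neg_sx, neg_sy, neg_mul_neg, neg_eq_zero] using h

lemma neg_perimeter [NeZero n] (P : RectPolygon n) : P.neg.perimeter = P.perimeter := by
  refine Finset.sum_congr rfl fun z _ => ?_
  change |P.neg.sx z| + |P.neg.sy z| = |P.sx z| + |P.sy z|
  rw [neg_sx, neg_sy, abs_neg, abs_neg]

lemma neg_rT (P : RectPolygon n) : P.neg.rT = P.rB := by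
  simp only [rT, rB, upperReflex, lowerReflex, reflexAt, neg_cross, neg_sx, horiz_iff_sy, neg_sy,
    neg_eq_zero, neg_lt_zero]

lemma neg_rB (P : RectPolygon n) : P.neg.rB = P.rT := by
  simp only [rT, rB, upperReflex, lowerReflex, reflexAt, neg_cross, neg_sx, horiz_iff_sy, neg_sy,
    neg_eq_zero, neg_pos]

lemma neg_ccw [NeZero n] {P : RectPolygon n} (h : P.ccw) : P.neg.ccw := by
  have H : ∀ z, cross (P.neg.v z) (P.neg.v (z + 1)) = cross (P.v z) (P.v (z + 1)) := fun z => by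
    simp [cross, neg]
  simpa only [ccw, H] using h

lemma upperReflex_iff (P : RectPolygon n) {z z' : ZMod n} (hz : z' + 1 = z) {p q r s : ℤ}
    (h : P.sx z' = p ∧ P.sy z' = q) (h' : P.sx z = r ∧ P.sy z = s) :
    P.upperReflex z ↔ p * s - q * r < 0 ∧ (q = 0 ∧ p < 0 ∨ s = 0 ∧ r < 0) := by
  obtain rfl : z' = z - 1 := by rw [← hz, add_sub_cancel_right]
  rw [upperReflex, reflexAt, cross_eq, horiz_iff_sy, horiz_iff_sy, h.1, h.2, h'.1, h'.2]

lemma lowerReflex_iff (P : RectPolygon n) {z z' : ZMod n} (hz : z' + 1 = z) {p q r s : ℤ}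
    (h : P.sx z' = p ∧ P.sy z' = q) (h' : P.sx z = r ∧ P.sy z = s) :
    P.lowerReflex z ↔ p * s - q * r < 0 ∧ (q = 0 ∧ 0 < p ∨ s = 0 ∧ 0 < r) := by
  obtain rfl : z' = z - 1 := by rw [← hz, add_sub_cancel_right]
  rw [lowerReflex, reflexAt, cross_eq, horiz_iff_sy, horiz_iff_sy, h.1, h.2, h'.1, h'.2]

end RectPolygon

lemma realizes_congr {n : ℕ} [NeZero n] {S : List Bool} {P Q : RectPolygon n}
    (hP : realizes S P) (hQ : Q.ccw) (hconv : ∀ z, P.convexAt z ↔ Q.convexAt z)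
    (hrefl : ∀ z, P.reflexAt z ↔ Q.reflexAt z) : realizes S Q :=
  ⟨hP.1, hQ, fun i => ⟨(hP.2.2 i).1.trans (hconv _), (hP.2.2 i).2.trans (hrefl _)⟩⟩

lemma ncard_eq_sum_ite {α : Type*} [Fintype α] (p : α → Prop) [DecidablePred p] :
    (({x | p x}.ncard : ℕ) : ℤ) = ∑ x, if p x then 1 else 0 := by
  rw [Set.ncard_eq_toFinset_card', Finset.sum_boole]
  simp

namespace Traces

variable {n : ℕ} {P Q : RectPolygon n} {k : ZMod n} {a b : ℕ} {X T Y B X' T' Y' B' : ℕ → ℤ}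

lemma sameDirections [NeZero n] (h : Traces P.v k a b X T Y B) (hc : ChainPair a b X T Y B)
    (h' : Traces Q.v k a b X' T' Y' B') (hc' : ChainPair a b X' T' Y' B')
    (hT : ∀ i < a, T' (i + 1) - T' i = (T (i + 1) - T i).sign)
    (hB : ∀ j < b, B' (j + 1) - B' j = (B (j + 1) - B j).sign) : P.SameDirections Q := by
  intro z
  have hpos : ∀ x y : ℤ, 0 < x → 0 < y → x.sign = y.sign := fun x y hx hy => by
    rw [Int.sign_eq_one_of_pos hx, Int.sign_eq_one_of_pos hy]
  have hneg : ∀ x y : ℤ, x < 0 → y < 0 → x.sign = y.sign := fun x y hx hy => by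
    rw [Int.sign_eq_neg_one_of_neg hx, Int.sign_eq_neg_one_of_neg hy]
  obtain ⟨t, -, rfl, ht⟩ := h.edge_cases z
  rcases ht with ⟨j, hj, rfl, -⟩ | ⟨j, hj, rfl, -⟩ | ⟨rfl, -⟩ | ⟨i, hi, ht, -⟩ | ⟨i, hi, ht, -⟩ |
    ⟨rfl, -⟩
  · rw [(h.lower_horiz hj).1, (h.lower_horiz hj).2, (h'.lower_horiz hj).1, (h'.lower_horiz hj).2]
    exact ⟨hpos _ _ (sub_pos.mpr (hc.ltY j hj)) (sub_pos.mpr (hc'.ltY j hj)), rfl⟩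
  · rw [(h.lower_vert hj).1, (h.lower_vert hj).2, (h'.lower_vert hj).1, (h'.lower_vert hj).2,
      hB j hj, Int.sign_sign]
    exact ⟨rfl, rfl⟩
  · rw [(h.right_vert hc.right).1, (h.right_vert hc.right).2, (h'.right_vert hc'.right).1,
      (h'.right_vert hc'.right).2]
    exact ⟨rfl, hpos _ _ (sub_pos.mpr hc.sep_right) (sub_pos.mpr hc'.sep_right)⟩
  · obtain rfl : t = 2 * a + 2 * b + 2 - 2 * i := by omega
    rw [(h.upper_horiz hi).1, (h.upper_horiz hi).2, (h'.upper_horiz hi).1, (h'.upper_horiz hi).2]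
    exact ⟨hneg _ _ (sub_neg.mpr (hc.ltX i hi)) (sub_neg.mpr (hc'.ltX i hi)), rfl⟩
  · obtain rfl : t = 2 * a + 2 * b + 1 - 2 * i := by omega
    rw [(h.upper_vert hi).1, (h.upper_vert hi).2, (h'.upper_vert hi).1, (h'.upper_vert hi).2,
      ← neg_sub (T' (i + 1)), hT i hi, ← neg_sub (T (i + 1)), Int.sign_neg, Int.sign_neg,
      Int.sign_sign]
    exact ⟨rfl, rfl⟩
  · rw [(h.left_vert hc.left).1, (h.left_vert hc.left).2, (h'.left_vert hc'.left).1,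
      (h'.left_vert hc'.left).2]
    exact ⟨rfl, hneg _ _ (sub_neg.mpr hc.sep_left) (sub_neg.mpr hc'.sep_left)⟩

lemma sum_vertices [NeZero n] (h : Traces P.v k a b X T Y B) (U : ZMod n → ℤ) :
    ∑ z, U z = U (k + ((2 * 0 : ℕ) : ZMod n)) + U (k + ((2 * b + 1 : ℕ) : ZMod n)) +
      U (k + ((2 * a + 2 * b + 2 - 2 * a : ℕ) : ZMod n)) +
      U (k + ((2 * a + 2 * b + 3 : ℕ) : ZMod n)) +
      ∑ j ∈ Finset.range b, (U (k + ((2 * j + 1 : ℕ) : ZMod n)) +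
        U (k + ((2 * (j + 1) : ℕ) : ZMod n))) +
      ∑ i ∈ Finset.range a, (U (k + ((2 * a + 2 * b + 1 - 2 * i : ℕ) : ZMod n)) +
        U (k + ((2 * a + 2 * b + 2 - 2 * i : ℕ) : ZMod n))) := by
  rw [sum_edges k h.len, Finset.sum_range_succ', Finset.sum_range_succ _ a,
    Finset.sum_add_distrib, Finset.sum_add_distrib]
  ring

lemma add_one_eq (k : ZMod n) {s t : ℕ} (hst : s + 1 = t) :
    k + (s : ZMod n) + 1 = k + (t : ZMod n) := by
  rw [succ_natCast, hst]

lemma rT_eq [NeZero n] (h : Traces P.v k a b X T Y B) (hc : ChainPair a b X T Y B) :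
    P.rT = a := by
  classical
  have hr := h.right_vert hc.right
  have hl := h.left_vert hc.left
  have hsr := hc.sep_right
  have hsl := hc.sep_left
  have hY0 := hc.ltY 0 (Nat.zero_le _)
  have hYb := hc.ltY b le_rfl
  have hX0 := hc.ltX 0 (Nat.zero_le _)
  have hXa := hc.ltX a le_rfl
  have hk : k + ((2 * a + 2 * b + 3 : ℕ) : ZMod n) + 1 = k + ((2 * 0 : ℕ) : ZMod n) := by
    rw [succ_natCast, show 2 * a + 2 * b + 3 + 1 = n from h.len.symm]
    simp
  have hz : (P.rT : ℤ) = a := by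
    rw [RectPolygon.rT, ncard_eq_sum_ite, h.sum_vertices,
      if_neg, if_neg, if_neg, if_neg, Finset.sum_eq_zero,
      Finset.sum_congr rfl (g := fun _ => (1 : ℤ))]
    · simp
    · intro i hi
      rw [Finset.mem_range] at hi
      have h1 := h.upper_horiz (i := i + 1) hi
      have h2 := h.upper_vert hi
      have h3 := h.upper_horiz hi.le
      have hX1 := hc.ltX (i + 1) hi
      have hX2 := hc.ltX i hi.le
      have hne := hc.neT i hi
      rw [if_congr (P.upperReflex_iff (add_one_eq k (by omega)) h1 h2) rfl rfl,
        if_congr (P.upperReflex_iff (add_one_eq k (by omega)) h2 h3) rfl rfl]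
      rcases lt_or_gt_of_ne hne with h4 | h4
      · rw [if_pos, if_neg]
        · rfl
        · rintro ⟨h5, -⟩
          nlinarith
        · exact ⟨by nlinarith, Or.inl ⟨rfl, by omega⟩⟩
      · rw [if_neg, if_pos]
        · rfl
        · exact ⟨by nlinarith, Or.inr ⟨rfl, by omega⟩⟩
        · rintro ⟨h5, -⟩
          nlinarith
    · intro j hj
      rw [Finset.mem_range] at hj
      have h1 := h.lower_horiz hj.le
      have h2 := h.lower_vert hj
      have h3 := h.lower_horiz (j := j + 1) hj
      have hY1 := hc.ltY (j + 1) hj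
      have hY2 := hc.ltY j hj.le
      rw [if_neg, if_neg]
      · rfl
      · rw [P.upperReflex_iff (add_one_eq k (by omega)) h2 h3]
        omega
      · rw [P.upperReflex_iff (add_one_eq k (by omega)) h1 h2]
        omega
    · rw [P.upperReflex_iff (add_one_eq k (by omega)) (h.upper_horiz (Nat.zero_le _)) hl]
      rintro ⟨h5, -⟩
      nlinarith
    · rw [P.upperReflex_iff (add_one_eq k (by omega)) hr (h.upper_horiz le_rfl)]
      rintro ⟨h5, -⟩
      nlinarith
    · rw [P.upperReflex_iff (add_one_eq k (by omega)) (h.lower_horiz le_rfl) hr]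
      omega
    · rw [P.upperReflex_iff hk hl (h.lower_horiz (Nat.zero_le _))]
      omega
  exact_mod_cast hz

lemma rB_eq [NeZero n] (h : Traces P.v k a b X T Y B) (hc : ChainPair a b X T Y B) :
    P.rB = b := by
  classical
  have hr := h.right_vert hc.right
  have hl := h.left_vert hc.left
  have hsr := hc.sep_right
  have hsl := hc.sep_left
  have hY0 := hc.ltY 0 (Nat.zero_le _)
  have hYb := hc.ltY b le_rfl
  have hX0 := hc.ltX 0 (Nat.zero_le _)
  have hXa := hc.ltX a le_rfl
  have hk : k + ((2 * a + 2 * b + 3 : ℕ) : ZMod n) + 1 = k + ((2 * 0 : ℕ) : ZMod n) := by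
    rw [succ_natCast, show 2 * a + 2 * b + 3 + 1 = n from h.len.symm]
    simp
  have hz : (P.rB : ℤ) = b := by
    rw [RectPolygon.rB, ncard_eq_sum_ite, h.sum_vertices,
      if_neg, if_neg, if_neg, if_neg, Finset.sum_congr rfl (g := fun _ => (1 : ℤ)),
      Finset.sum_eq_zero (s := Finset.range a)]
    · simp
    · intro i hi
      rw [Finset.mem_range] at hi
      have h1 := h.upper_horiz (i := i + 1) hi
      have h2 := h.upper_vert hi
      have h3 := h.upper_horiz hi.le
      have hX1 := hc.ltX (i + 1) hi
      have hX2 := hc.ltX i hi.le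
      rw [if_neg, if_neg]
      · rfl
      · rw [P.lowerReflex_iff (add_one_eq k (by omega)) h2 h3]
        omega
      · rw [P.lowerReflex_iff (add_one_eq k (by omega)) h1 h2]
        omega
    · intro j hj
      rw [Finset.mem_range] at hj
      have h1 := h.lower_horiz hj.le
      have h2 := h.lower_vert hj
      have h3 := h.lower_horiz (j := j + 1) hj
      have hY1 := hc.ltY (j + 1) hj
      have hY2 := hc.ltY j hj.le
      have hne := hc.neB j hj
      rw [if_congr (P.lowerReflex_iff (add_one_eq k (by omega)) h1 h2) rfl rfl,
        if_congr (P.lowerReflex_iff (add_one_eq k (by omega)) h2 h3) rfl rfl]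
      rcases lt_or_gt_of_ne hne with h4 | h4
      · rw [if_pos, if_neg]
        · rfl
        · rintro ⟨h5, -⟩
          nlinarith
        · exact ⟨by nlinarith, Or.inl ⟨rfl, by omega⟩⟩
      · rw [if_neg, if_pos]
        · rfl
        · exact ⟨by nlinarith, Or.inr ⟨rfl, by omega⟩⟩
        · rintro ⟨h5, -⟩
          nlinarith
    · rw [P.lowerReflex_iff (add_one_eq k (by omega)) (h.upper_horiz (Nat.zero_le _)) hl]
      omega
    · rw [P.lowerReflex_iff (add_one_eq k (by omega)) hr (h.upper_horiz le_rfl)]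
      omega
    · rw [P.lowerReflex_iff (add_one_eq k (by omega)) (h.lower_horiz le_rfl) hr]
      rintro ⟨h5, -⟩
      nlinarith
    · rw [P.lowerReflex_iff hk hl (h.lower_horiz (Nat.zero_le _))]
      rintro ⟨h5, -⟩
      nlinarith
  exact_mod_cast hz

lemma fst_mem_Icc [NeZero n] (h : Traces P.v k a b X T Y B) (hc : ChainPair a b X T Y B)
    (z : ZMod n) : X 0 ≤ (P.v z).1 ∧ (P.v z).1 ≤ X (a + 1) := by
  have hl := hc.left
  have hr := hc.right
  have uX : ∀ i ≤ a + 1, X 0 ≤ X i ∧ X i ≤ X (a + 1) := fun i hi => by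
    have h1 := le_of_step_lt (m := a + 1) (fun i hi => hc.ltX i (by omega)) (Nat.zero_le i) hi
    have h2 := le_of_step_lt (m := a + 1) (fun i hi => hc.ltX i (by omega)) hi le_rfl
    omega
  have uY : ∀ j ≤ b + 1, Y 0 ≤ Y j ∧ Y j ≤ Y (b + 1) := fun j hj => by
    have h1 := le_of_step_lt (m := b + 1) (fun i hi => hc.ltY i (by omega)) (Nat.zero_le j) hj
    have h2 := le_of_step_lt (m := b + 1) (fun i hi => hc.ltY i (by omega)) hj le_rfl
    omega
  obtain ⟨t, -, -, ht⟩ := h.edge_cases z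
  rcases ht with ⟨j, hj, -, h1, -⟩ | ⟨j, hj, -, h1, -⟩ | ⟨-, h1, -⟩ | ⟨i, hi, -, h1, -⟩ |
    ⟨i, hi, -, h1, -⟩ | ⟨-, h1, -⟩ <;> rw [h1] <;> dsimp only
  · have := uY j (by omega)
    omega
  · have := uY (j + 1) (by omega)
    omega
  · have := uY (b + 1) (by omega)
    omega
  · exact uX (i + 1) (by omega)
  · exact uX (i + 1) (by omega)
  · exact uX 0 (by omega)

lemma minX_eq [NeZero n] (h : Traces P.v k a b X T Y B) (hc : ChainPair a b X T Y B) :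
    P.minX = X 0 := by
  refine le_antisymm ?_ (Finset.le_inf' _ _ fun z _ => (h.fst_mem_Icc hc z).1)
  refine (Finset.inf'_le _ (Finset.mem_univ
    (k + ((2 * a + 2 * b + 3 - 2 * 0 : ℕ) : ZMod n)))).trans ?_
  rw [h.upper_left 0 (Nat.zero_le _)]

lemma maxX_eq [NeZero n] (h : Traces P.v k a b X T Y B) (hc : ChainPair a b X T Y B) :
    P.maxX = X (a + 1) := by
  refine le_antisymm (Finset.sup'_le _ _ fun z _ => (h.fst_mem_Icc hc z).2) ?_
  refine le_trans ?_ (Finset.le_sup' (fun z => (P.v z).1) (Finset.mem_univ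
    (k + ((2 * a + 2 * b + 2 - 2 * a : ℕ) : ZMod n))))
  rw [h.upper_right a le_rfl]

lemma periCanonical [NeZero n] (h : Traces P.v k a b X T Y B) (hc : ChainPair a b X T Y B)
    (hX : ∀ i ≤ a, X (i + 1) = X i + 1) (hT : ∀ i < a, |T (i + 1) - T i| = 1)
    (hB : ∀ j < b, |B (j + 1) - B j| = 1) : periCanonical P := by
  have he : ∀ z, P.elen z = |P.sx z| + |P.sy z| := fun _ => rfl
  constructor
  · intro z hz h1 h2
    rw [h.minX_eq hc] at h1
    rw [h.maxX_eq hc] at h2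
    rw [P.vert_iff_sx] at hz
    rw [he, hz]
    obtain ⟨t, -, rfl, ht⟩ := h.edge_cases z
    rcases ht with ⟨j, hj, rfl, -⟩ | ⟨j, hj, rfl, -⟩ | ⟨rfl, h3, -⟩ | ⟨i, hi, ht, -⟩ |
      ⟨i, hi, ht, -⟩ | ⟨rfl, h3, -⟩
    · have := hc.ltY j hj
      rw [(h.lower_horiz hj).1] at hz
      omega
    · rw [(h.lower_vert hj).2, hB j hj]
      rfl
    · rw [h3] at h2
      exact absurd hc.right.symm h2
    · obtain rfl : t = 2 * a + 2 * b + 2 - 2 * i := by omega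
      have := hc.ltX i hi
      rw [(h.upper_horiz hi).1] at hz
      omega
    · obtain rfl : t = 2 * a + 2 * b + 1 - 2 * i := by omega
      rw [(h.upper_vert hi).2, abs_sub_comm, hT i hi]
      rfl
    · rw [h3] at h1
      exact absurd rfl h1
  · intro z hz h1
    rw [P.horiz_iff_sy] at hz
    rw [he, hz]
    obtain ⟨t, -, rfl, ht⟩ := h.edge_cases z
    rcases ht with ⟨j, hj, rfl, -⟩ | ⟨j, hj, rfl, -⟩ | ⟨rfl, -⟩ | ⟨i, hi, ht, -⟩ |
      ⟨i, hi, ht, -⟩ | ⟨rfl, -⟩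
    · have := hc.ltY j hj
      rw [(h.lower_horiz hj).1] at h1
      omega
    · rw [(h.lower_vert hj).1] at h1
      omega
    · rw [(h.right_vert hc.right).1] at h1
      omega
    · obtain rfl : t = 2 * a + 2 * b + 2 - 2 * i := by omega
      rw [(h.upper_horiz hi).1, hX i hi]
      simp
    · obtain rfl : t = 2 * a + 2 * b + 1 - 2 * i := by omega
      rw [(h.upper_vert hi).1] at h1
      omega
    · rw [(h.left_vert hc.left).1] at h1
      omega

end Traces

namespace RectPolygon

variable {n : ℕ}

/-- In an x-monotone polygon, the x-directions of the horizontal edges form one run of positive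
directions followed by one run of negative directions. -/
lemma IsXMonotone.exists_runs [NeZero n] {P : RectPolygon n} (hP : P.IsXMonotone) :
    ∃ (k : ZMod n) (a b : ℕ), n = 2 * a + 2 * b + 4 ∧ P.horiz k ∧
      (∀ t ≤ b, 0 < P.sx (k + ((2 * t : ℕ) : ZMod n))) ∧
      ∀ t, b < t → t ≤ a + b + 1 → P.sx (k + ((2 * t : ℕ) : ZMod n)) < 0 := by
  obtain ⟨p, q, hpq, hR⟩ := Set.ncard_eq_two.mp hP
  have hmem : ∀ z, (P.horiz z ∧ P.sx z * P.sx (z + 2) < 0) ↔ z = p ∨ z = q := fun z => by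
    have := Set.ext_iff.mp hR z
    simpa using this
  obtain ⟨hp, hp'⟩ := (hmem p).mpr (Or.inl rfl)
  obtain ⟨hq, hq'⟩ := (hmem q).mpr (Or.inr rfl)
  obtain ⟨m, hm⟩ : Even n := (P.horiz_add_iff hp n).mp (by simpa using hp)
  obtain ⟨r, hr, rfl⟩ := exists_natCast_add p q
  obtain ⟨s, rfl⟩ := (P.horiz_add_iff hp r).mp hq
  have hs0 : s ≠ 0 := by
    rintro rfl
    simp at hpq
  have hsm : s < m := by omega
  set f : ℕ → ℤ := fun t => P.sx (p + ((2 * t : ℕ) : ZMod n)) with hf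
  have hcast : ∀ t : ℕ, p + ((2 * t : ℕ) : ZMod n) + 2 = p + ((2 * (t + 1) : ℕ) : ZMod n) :=
    fun t => by
      push_cast
      ring
  have hhor : ∀ t : ℕ, P.horiz (p + ((2 * t : ℕ) : ZMod n)) := fun t =>
    (P.horiz_add_iff hp _).mpr (even_two_mul t)
  have hne : ∀ t, f t ≠ 0 := fun t => P.sx_ne_zero (hhor t)
  have hper : ∀ t, f (t + m) = f t := fun t => by
    have h1 : ((2 * (t + m) : ℕ) : ZMod n) = ((2 * t : ℕ) : ZMod n) := by
      rw [show 2 * (t + m) = 2 * t + n by omega]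
      simp
    simp only [hf, h1]
  have h0 : f 0 * f (0 + 1) < 0 := by
    simpa [hf] using hp'
  have hs : f s * f (s + 1) < 0 := by
    have h1 := hq'
    rw [← two_mul, hcast] at h1
    exact h1
  have hstep : ∀ t, 0 < t → t < m → t ≠ s → (0 < f (t + 1) ↔ 0 < f t) := fun t ht0 htm hts => by
    have h1 := (hmem (p + ((2 * t : ℕ) : ZMod n))).not.mpr (by
      rintro (h | h)
      · have := natCast_eq_of_add_eq (k := p) (s := 2 * t) (t := 0) (by omega) (by omega)
          (by simpa using h)
        omega
      · have := natCast_eq_of_add_eq (k := p) (s := 2 * t) (t := s + s) (by omega) (by omega) h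
        omega)
    rw [hcast] at h1
    have h2 : 0 ≤ f t * f (t + 1) := not_lt.mp fun h => h1 ⟨hhor t, h⟩
    have h3 := hne t
    have h4 := hne (t + 1)
    constructor
    · intro h5
      by_contra h6
      nlinarith [lt_of_le_of_ne (not_lt.mp h6) h3]
    · intro h5
      by_contra h6
      nlinarith [lt_of_le_of_ne (not_lt.mp h6) h4]
  have hflip : ∀ t, f t * f (t + 1) < 0 → (0 < f (t + 1) ↔ ¬ 0 < f t) := fun t ht => by
    have h3 := hne t
    constructor
    · intro h5 h6
      nlinarith
    · intro h5
      have := lt_of_le_of_ne (not_lt.mp h5) h3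
      nlinarith
  have hrun₁ : ∀ t, 1 ≤ t → t ≤ s → (0 < f t ↔ ¬ 0 < f 0) := fun t ht => by
    induction t, ht using Nat.le_induction with
    | base => exact fun _ => hflip 0 h0
    | succ t ht ih =>
      exact fun hts => (hstep t ht (by omega) (by omega)).trans (ih (by omega))
  have hrun₂ : ∀ t, s + 1 ≤ t → t ≤ m → (0 < f t ↔ 0 < f 0) := fun t ht => by
    induction t, ht using Nat.le_induction with
    | base =>
      intro _
      rw [hflip s hs, hrun₁ s (by omega) le_rfl, not_not]
    | succ t ht ih =>
      exact fun htm => (hstep t (by omega) (by omega) (by omega)).trans (ih (by omega))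
  have hneg : ∀ t, ¬ 0 < f t → f t < 0 := fun t ht => lt_of_le_of_ne (not_lt.mp ht) (hne t)
  have hshift : ∀ u t : ℕ, P.sx (p + ((2 * u : ℕ) : ZMod n) + ((2 * t : ℕ) : ZMod n)) =
      f (u + t) := fun u t => by
    simp only [hf]
    congr 1
    push_cast
    ring
  by_cases hσ : 0 < f 0
  · refine ⟨p + ((2 * (s + 1) : ℕ) : ZMod n), s - 1, m - s - 1, by omega, hhor _, fun t ht => ?_,
      fun t ht ht' => ?_⟩
    · rw [hshift]
      exact (hrun₂ _ (by omega) (by omega)).mpr hσ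
    · rw [hshift, show s + 1 + t = (s + 1 + t - m) + m by omega, hper]
      exact hneg _ fun h => (hrun₁ _ (by omega) (by omega)).mp h hσ
  · refine ⟨p + ((2 * 1 : ℕ) : ZMod n), m - s - 1, s - 1, by omega, hhor _, fun t ht => ?_,
      fun t ht ht' => ?_⟩
    · rw [hshift]
      exact (hrun₁ _ (by omega) (by omega)).mpr hσ
    · rw [hshift]
      exact hneg _ fun h => hσ ((hrun₂ _ (by omega) (by omega)).mp h)

end RectPolygon

namespace RectPolygon

variable {n : ℕ}

lemma not_onSeg_of_not_adjacent (P : RectPolygon n) (k : ZMod n) {s t : ℕ} (hst : s + 1 < t)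
    (htn : t + 1 < n) {p : ℤ × ℤ}
    (hs : onSeg (P.v (k + (s : ZMod n))) (P.v (k + ((s + 1 : ℕ) : ZMod n))) p) :
    ¬ onSeg (P.v (k + (t : ZMod n))) (P.v (k + ((t + 1 : ℕ) : ZMod n))) p := by
  intro ht
  rw [← Traces.succ_natCast] at hs ht
  have hne : k + (t : ZMod n) ≠ k + (s : ZMod n) := fun h => by
    have := natCast_eq_of_add_eq (by omega) (by omega) h
    omega
  rcases P.simple _ _ hne p hs ht with ⟨h, -⟩ | ⟨h, -⟩
  · rw [Traces.succ_natCast] at h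
    have := natCast_eq_of_add_eq (by omega) (by omega) h
    omega
  · rw [Traces.succ_natCast] at h
    have := natCast_eq_of_add_eq (by omega) (by omega) h
    omega

/-- The boundary of a counterclockwise x-monotone polygon runs along a lower and an upper
staircase. -/
lemma exists_traces [NeZero n] {P : RectPolygon n} (hccw : P.ccw) (hP : P.IsXMonotone) :
    ∃ (k : ZMod n) (a b : ℕ) (X T Y B : ℕ → ℤ),
      ChainPair a b X T Y B ∧ Traces P.v k a b X T Y B := by
  obtain ⟨k, a, b, hn, hk, hlow, hupp⟩ := hP.exists_runs
  have hH : ∀ t : ℕ, (P.v (k + ((2 * t + 1 : ℕ) : ZMod n))).2 =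
      (P.v (k + ((2 * t : ℕ) : ZMod n))).2 := fun t => by
    have h1 : P.horiz (k + ((2 * t : ℕ) : ZMod n)) := (P.horiz_add_iff hk _).mpr (even_two_mul t)
    rwa [horiz, Traces.succ_natCast] at h1
  have hV : ∀ t : ℕ, (P.v (k + ((2 * t + 2 : ℕ) : ZMod n))).1 =
      (P.v (k + ((2 * t + 1 : ℕ) : ZMod n))).1 := fun t => by
    have h1 : ¬ P.horiz (k + ((2 * t + 1 : ℕ) : ZMod n)) :=
      (P.horiz_add_iff hk _).not.mpr (by simp)
    rwa [horiz_iff_not_vert, not_not, vert, Traces.succ_natCast] at h1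
  have hwrap : k + ((2 * a + 2 * b + 4 : ℕ) : ZMod n) = k + ((2 * 0 : ℕ) : ZMod n) := by
    rw [← hn]
    simp
  let X : ℕ → ℤ := fun i => (P.v (k + ((2 * a + 2 * b + 3 - 2 * i : ℕ) : ZMod n))).1
  let T : ℕ → ℤ := fun i => (P.v (k + ((2 * a + 2 * b + 3 - 2 * i : ℕ) : ZMod n))).2
  let Y : ℕ → ℤ := fun j => (P.v (k + ((2 * j : ℕ) : ZMod n))).1
  let B : ℕ → ℤ := fun j => (P.v (k + ((2 * j : ℕ) : ZMod n))).2
  have tr : Traces P.v k a b X T Y B := by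
    refine ⟨hn, fun j hj => rfl, fun j hj => ?_, fun i hi => rfl, fun i hi => ?_⟩
    · exact Prod.ext (hV j).symm (hH j)
    · obtain ⟨u, hu⟩ : ∃ u, a + b = i + u := ⟨a + b - i, by omega⟩
      have h1 := hV u
      have h2 := hH (u + 1)
      refine Prod.ext ?_ ?_
      · simp only [X]
        rw [show 2 * a + 2 * b + 2 - 2 * i = 2 * u + 2 by omega,
          show 2 * a + 2 * b + 3 - 2 * (i + 1) = 2 * u + 1 by omega, h1]
      · simp only [T]
        rw [show 2 * a + 2 * b + 2 - 2 * i = 2 * (u + 1) by omega,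
          show 2 * a + 2 * b + 3 - 2 * i = 2 * (u + 1) + 1 by omega, h2]
  have left : X 0 = Y 0 := by
    have h1 := hV (a + b + 1)
    rw [show 2 * (a + b + 1) + 2 = 2 * a + 2 * b + 4 by omega, hwrap] at h1
    simp only [X, Y]
    rw [show 2 * a + 2 * b + 3 - 2 * 0 = 2 * (a + b + 1) + 1 by omega, h1]
  have right : X (a + 1) = Y (b + 1) := by
    have h1 := hV b
    simp only [X, Y]
    rw [show 2 * a + 2 * b + 3 - 2 * (a + 1) = 2 * b + 1 by omega, ← h1,
      show 2 * (b + 1) = 2 * b + 2 by omega]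
  have ltX : ∀ i ≤ a, X i < X (i + 1) := fun i hi => by
    have h1 := hupp (a + b + 1 - i) (by omega) (by omega)
    rw [show 2 * (a + b + 1 - i) = 2 * a + 2 * b + 2 - 2 * i by omega, (tr.upper_horiz hi).1] at h1
    omega
  have ltY : ∀ j ≤ b, Y j < Y (j + 1) := fun j hj => by
    have h1 := hlow j hj
    rw [(tr.lower_horiz hj).1] at h1
    omega
  have hsy : ∀ z, P.sx z = 0 → P.sy z ≠ 0 := fun z hz hz' =>
    (P.horiz_iff_not_vert z).mp ((P.horiz_iff_sy z).mpr hz') ((P.vert_iff_sx z).mpr hz)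
  have neT : ∀ i < a, T (i + 1) ≠ T i := fun i hi h => by
    have h1 := tr.upper_vert hi
    exact hsy _ h1.1 (by rw [h1.2, h, sub_self])
  have neB : ∀ j < b, B (j + 1) ≠ B j := fun j hj h => by
    have h1 := tr.lower_vert hj
    exact hsy _ h1.1 (by rw [h1.2, h, sub_self])
  have hTB : ∀ i < a, ∀ j ≤ b, Y j ≤ X (i + 1) → X (i + 1) ≤ Y (j + 1) →
      ¬ (min (T i) (T (i + 1)) ≤ B j ∧ B j ≤ max (T i) (T (i + 1))) := fun i hi j hj h1 h2 h3 => by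
    refine P.not_onSeg_of_not_adjacent k (s := 2 * j) (t := 2 * a + 2 * b + 1 - 2 * i)
      (p := (X (i + 1), B j)) (by omega) (by omega) ?_ ?_
    · rw [tr.lower_left j hj, tr.lower_right j hj]
      simp only [onSeg]
      omega
    · rw [show 2 * a + 2 * b + 1 - 2 * i + 1 = 2 * a + 2 * b + 2 - 2 * i by omega,
        tr.upper_right i hi.le,
        show 2 * a + 2 * b + 1 - 2 * i = 2 * a + 2 * b + 3 - 2 * (i + 1) by omega,
        tr.upper_left (i + 1) hi]
      simp only [onSeg]
      omega
  have hBT : ∀ j < b, ∀ i ≤ a, X i ≤ Y (j + 1) → Y (j + 1) ≤ X (i + 1) →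
      ¬ (min (B j) (B (j + 1)) ≤ T i ∧ T i ≤ max (B j) (B (j + 1))) := fun j hj i hi h1 h2 h3 => by
    refine P.not_onSeg_of_not_adjacent k (s := 2 * j + 1) (t := 2 * a + 2 * b + 2 - 2 * i)
      (p := (Y (j + 1), T i)) (by omega) (by omega) ?_ ?_
    · rw [show 2 * j + 1 + 1 = 2 * (j + 1) by omega, tr.lower_left (j + 1) hj,
        tr.lower_right j hj.le]
      simp only [onSeg]
      omega
    · rw [show 2 * a + 2 * b + 2 - 2 * i + 1 = 2 * a + 2 * b + 3 - 2 * i by omega,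
        tr.upper_right i hi, tr.upper_left i hi]
      simp only [onSeg]
      omega
  have h0 : B 0 ≠ T 0 := fun h => by
    have h1 := tr.left_vert left
    exact hsy _ h1.1 (by rw [h1.2, h, sub_self])
  refine ⟨k, a, b, X, T, Y, B, ⟨ltX, ltY, left, right, neT, neB, ?_⟩, tr⟩
  rcases lt_or_gt_of_ne h0 with h0 | h0
  · exact sep_of_disjoint ltX ltY left hTB hBT h0
  · have h1 := area_pos_of_sep ltY ltX left.symm right.symm
      (sep_of_disjoint ltY ltX left.symm hBT hTB h0)
    rw [ccw, tr.shoelace left right] at hccw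
    omega

end RectPolygon

/-- Every x-monotone polygon is at least as long as some perimeter-canonical one with the same
angle sequence. -/
lemma exists_periCanonical {n : ℕ} [NeZero n] {S : List Bool} {P : RectPolygon n}
    (hS : realizes S P) (hP : P.IsXMonotone) :
    ∃ Q : RectPolygon n, realizes S Q ∧ Q.IsXMonotone ∧ Q.rB ≤ Q.rT ∧ periCanonical Q ∧
      Q.perimeter ≤ P.perimeter ∧ ∃ iL iR : ZMod n,
        Q.vert iL ∧ (Q.v iL).1 = Q.minX ∧ Q.vert iR ∧ (Q.v iR).1 = Q.maxX ∧
        Q.perimeter = 3 * (Q.rT : ℤ) + (Q.rB : ℤ) + 2 + Q.elen iL + Q.elen iR := by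
  wlog hr : P.rB ≤ P.rT generalizing P
  · have hneg : realizes S P.neg := realizes_congr hS (RectPolygon.neg_ccw hS.2.1)
      (fun z => by simp only [RectPolygon.convexAt, RectPolygon.neg_cross])
      (fun z => by simp only [RectPolygon.reflexAt, RectPolygon.neg_cross])
    have h := this hneg (RectPolygon.neg_isXMonotone hP)
      (by rw [RectPolygon.neg_rT, RectPolygon.neg_rB]; exact (not_le.mp hr).le)
    rwa [RectPolygon.neg_perimeter] at h
  obtain ⟨k, a, b, X, T, Y, B, hc, tr⟩ := RectPolygon.exists_traces hS.2.1 hP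
  rw [tr.rT_eq hc, tr.rB_eq hc] at hr
  obtain ⟨X', T', Y', B', hc', hX, hT, hB, hle⟩ := hc.exists_canonical hr
  obtain ⟨Q, tr'⟩ := exists_rectPolygon k tr.len hc'
  have hdir := tr.sameDirections hc tr' hc' hT hB
  have hT1 : ∀ i < a, |T' (i + 1) - T' i| = 1 := fun i hi => by
    rw [hT i hi, Int.abs_sign_of_ne_zero (sub_ne_zero.mpr (hc.neT i hi))]
  have hB1 : ∀ j < b, |B' (j + 1) - B' j| = 1 := fun j hj => by
    rw [hB j hj, Int.abs_sign_of_ne_zero (sub_ne_zero.mpr (hc.neB j hj))]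
  have hper : Q.perimeter = 2 * (a + 1 : ℤ) + a + b + (T' 0 - B' 0) + (T' a - B' b) := by
    rw [tr'.perimeter_eq hc', hX, hX,
      Finset.sum_congr rfl fun i hi => hT1 i (Finset.mem_range.mp hi),
      Finset.sum_congr rfl fun j hj => hB1 j (Finset.mem_range.mp hj)]
    simp
  have hl := tr'.left_vert hc'.left
  have hr := tr'.right_vert hc'.right
  have hsl := hc'.sep_left
  have hsr := hc'.sep_right
  refine ⟨Q, realizes_congr hS (tr'.ccw hc') hdir.convexAt_iff hdir.reflexAt_iff,
    hdir.isXMonotone hP, ?_, tr'.periCanonical hc' (fun i _ => ?_) hT1 hB1, ?_,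
    k + ((2 * a + 2 * b + 3 : ℕ) : ZMod n), k + ((2 * b + 1 : ℕ) : ZMod n),
    (Q.vert_iff_sx _).mpr hl.1, ?_, (Q.vert_iff_sx _).mpr hr.1, ?_, ?_⟩
  · rwa [tr'.rT_eq hc', tr'.rB_eq hc']
  · rw [hX, hX]
    push_cast
    rfl
  · rw [hper, tr.perimeter_eq hc]
    exact hle
  · rw [tr'.minX_eq hc', show 2 * a + 2 * b + 3 = 2 * a + 2 * b + 3 - 2 * 0 by omega,
      tr'.upper_left 0 (Nat.zero_le _)]
  · rw [tr'.maxX_eq hc', tr'.lower_right b le_rfl]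
    exact hc'.right.symm
  · have he : ∀ z, Q.elen z = |Q.sx z| + |Q.sy z| := fun _ => rfl
    rw [hper, tr'.rT_eq hc', tr'.rB_eq hc', he, he, hl.1, hl.2, hr.1, hr.2, abs_sub_comm (B' 0),
      abs_of_pos (sub_pos.mpr hsl), abs_of_pos (sub_pos.mpr hsr)]
    simp only [abs_zero]
    ring

/-- For any x-monotone angle sequence `S`, there is a perimeter-canonical
minimum-perimeter polygon `P` realizing `S` with `r(T) ≥ r(B)` such that
`peri(P) = 3·r(T) + r(B) + 2 + |e_L| + |e_R|`, where `e_L` and `e_R` are the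
leftmost and rightmost vertical edges. -/
theorem x_monotone_min_perimeter_formula (S : List Bool) [NeZero S.length]
    (hex : ∃ P : RectPolygon S.length, realizes S P ∧ P.IsXMonotone) :
    ∃ P : RectPolygon S.length, realizes S P ∧ P.IsXMonotone ∧
      P.rB ≤ P.rT ∧ periCanonical P ∧
      (∀ P' : RectPolygon S.length, realizes S P' → P'.IsXMonotone →
        P.perimeter ≤ P'.perimeter) ∧
      ∃ iL iR : ZMod S.length,
        P.vert iL ∧ (P.v iL).1 = P.minX ∧ P.vert iR ∧ (P.v iR).1 = P.maxX ∧
        P.perimeter = 3 * (P.rT : ℤ) + (P.rB : ℤ) + 2 + P.elen iL + P.elen iR := by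
  let C : Set (RectPolygon S.length) := {P | realizes S P ∧ P.IsXMonotone}
  have hC : C.Nonempty := hex
  let len : RectPolygon S.length → ℕ := fun P => P.perimeter.toNat
  obtain ⟨hS, hP⟩ : Function.argminOn len C hC ∈ C := Function.argminOn_mem len C hC
  obtain ⟨Q, h1, h2, h3, h4, h5, h6⟩ := exists_periCanonical hS hP
  refine ⟨Q, h1, h2, h3, h4, fun P' hS' hP' => h5.trans ?_, h6⟩
  have hmin : len (Function.argminOn len C hC) ≤ len P' :=
    Function.argminOn_le len C ⟨hS', hP'⟩
  have h0 : 0 ≤ P'.perimeter :=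
    Finset.sum_nonneg fun z _ => add_nonneg (abs_nonneg _) (abs_nonneg _)
  change Int.toNat _ ≤ Int.toNat _ at hmin
  omega
end

section
/- Let P be a minimum-perimeter xy-monotone lattice polygon with stair reflex-counts (r₁, r₂, r₃, r₄) for stairs TR, TL, BL, BR respectively (r(T) ≥ r(B)). Then peri(P) = 4r₁ + 6 if (r₁,r₂,r₃,r₄) = (r₁,0,r₁,0); peri(P) = 4r₂ + 6 if (r₁,r₂,r₃,r₄) = (0,r₂,0,r₂); and otherwise peri(P) = 3(r₁+r₂) + (r₃+r₄) + |r₂ + r₃ − r₁ − r₄| + 4. -/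
/-- The angle sequence of an xy-monotone polygon whose four stairs TL, BL, BR, TR
(in ccw order after the top extreme edge, which is edge 0) have `tl`, `bl`, `br`,
`tr` reflex vertices: cyclically L (LR)^tl L (LR)^bl L (LR)^br L (LR)^tr. -/
def xySeq (tl bl br tr : ℕ) : List Bool :=
  [true] ++ LRblock tl ++ [true] ++ LRblock bl ++ [true] ++ LRblock br ++ [true] ++ LRblock tr

/-- Orientation convention: the first extreme edge (edge 0, the top extreme edge)
is drawn horizontally, pointing leftwards (ccw walk). -/
def topPinned {n : ℕ} (P : RectPolygon n) : Prop := P.horiz 0 ∧ P.sx 0 < 0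

theorem length_LRblock (k : ℕ) : (LRblock k).length = 2 * k := by
  simp [LRblock]
  ring

theorem getElem?_LRblock (k i : ℕ) :
    (LRblock k)[i]? = if i < 2 * k then some (decide (i % 2 = 0)) else none := by
  induction k generalizing i with
  | zero => simp [LRblock]
  | succ k ih =>
    have h : LRblock (k + 1) = true :: false :: LRblock k := by
      simp [LRblock, List.replicate_succ]
    rw [h]
    match i with
    | 0 => simp
    | 1 => simp; omega
    | i + 2 =>
      simp only [List.getElem?_cons_succ, ih, Nat.add_mod_right]
      split_ifs <;> first | rfl | omega

theorem length_xySeq (b c d a : ℕ) :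
    (xySeq b c d a).length = 2 * (a + b + c + d) + 4 := by
  simp [xySeq, length_LRblock]
  ring

/-- The positions of the left turns in `xySeq b c d a`. -/
def IsLeftTurn (b c d k : ℕ) : Prop :=
  k = 0 ∨ (k ≤ 2 * b + 1 ∧ k % 2 = 1) ∨
    (2 * b + 2 ≤ k ∧ k ≤ 2 * (b + c) + 2 ∧ k % 2 = 0) ∨
    (2 * (b + c) + 3 ≤ k ∧ k ≤ 2 * (b + c + d) + 3 ∧ k % 2 = 1) ∨
    (2 * (b + c + d) + 4 ≤ k ∧ k % 2 = 0)

theorem xySeq_get_eq_true_iff (b c d a : ℕ) (i : Fin (xySeq b c d a).length) :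
    (xySeq b c d a).get i = true ↔ IsLeftTurn b c d i := by
  obtain ⟨i, hi⟩ := i
  rw [length_xySeq] at hi
  have h : (xySeq b c d a)[i]? = some true ↔ IsLeftTurn b c d i := by
    simp only [xySeq, List.getElem?_append, List.length_append, length_LRblock,
      getElem?_LRblock, List.length_singleton, List.getElem?_singleton, IsLeftTurn]
    split_ifs <;> simp <;> omega
  rw [← h, List.getElem?_eq_some_iff]
  simp [length_xySeq, hi]

theorem ZMod.sum_eq_sum_range {n : ℕ} [NeZero n] {M : Type*} [AddCommMonoid M] (g : ZMod n → M) :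
    ∑ i : ZMod n, g i = ∑ k ∈ Finset.range n, g (k : ZMod n) := by
  refine Finset.sum_nbij' (fun i => i.val) (fun k => (k : ZMod n)) ?_ ?_ ?_ ?_ ?_
  · intro i _; simpa using ZMod.val_lt i
  · intro k _; simp
  · intro i _; simp
  · intro k hk; exact ZMod.val_cast_of_lt (by simpa using hk)
  · intro i _; simp

/-- The `x`-coordinates of the canonical polygon with stairs of sizes `a, b, c, d`. -/
def stairX (a b c d k : ℕ) : ℤ :=
  if k = 0 then b + 1
  else if k ≤ 2 * b + 1 then b - ((k - 1 : ℤ) / 2)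
  else if k ≤ 2 * (b + c) + 2 then (k - 2 * b - 1 : ℤ) / 2
  else if k ≤ 2 * (b + c + d) + 3 then a + b + 1 - d + (k - 2 * (b + c) - 3 : ℤ) / 2
  else a + b + 1 - (k - 2 * (b + c + d) - 3 : ℤ) / 2

/-- The `y`-coordinates of the canonical polygon of height `H`. -/
def stairY (a b c d H k : ℕ) : ℤ :=
  if k ≤ 2 * b + 1 then H - (k : ℤ) / 2
  else if k ≤ 2 * (b + c) + 2 then c - (k - 2 * b - 2 : ℤ) / 2
  else if k ≤ 2 * (b + c + d) + 3 then (k - 2 * (b + c) - 2 : ℤ) / 2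
  else H - a + (k - 2 * (b + c + d) - 4 : ℤ) / 2

theorem stair_TL_even {a b c d H k t : ℕ} (ht : t ≤ b) (hk : k = 2 * t + 1) :
    stairX a b c d k = b - t ∧ stairY a b c d H k = H - t := by
  subst hk
  unfold stairX stairY
  rw [if_neg (by omega), if_pos (by omega), if_pos (by omega)]
  omega

theorem stair_TL_odd {a b c d H k t : ℕ} (ht : t < b) (hk : k = 2 * t + 2) :
    stairX a b c d k = b - t ∧ stairY a b c d H k = H - t - 1 := by
  subst hk
  unfold stairX stairY
  rw [if_neg (by omega), if_pos (by omega), if_pos (by omega)]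
  omega

theorem stair_BL_even {a b c d H k t : ℕ} (ht : t ≤ c) (hk : k = 2 * b + 2 + 2 * t) :
    stairX a b c d k = t ∧ stairY a b c d H k = c - t := by
  subst hk
  unfold stairX stairY
  rw [if_neg (by omega), if_neg (by omega), if_pos (by omega), if_neg (by omega),
    if_pos (by omega)]
  omega

theorem stair_BL_odd {a b c d H k t : ℕ} (ht : t < c) (hk : k = 2 * b + 3 + 2 * t) :
    stairX a b c d k = t + 1 ∧
      stairY a b c d H k = c - t := by
  subst hk
  unfold stairX stairY
  rw [if_neg (by omega), if_neg (by omega), if_pos (by omega), if_neg (by omega),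
    if_pos (by omega)]
  omega

theorem stair_BR_even {a b c d H k t : ℕ} (ht : t ≤ d) (hk : k = 2 * (b + c) + 3 + 2 * t) :
    stairX a b c d k = a + b + 1 - d + t ∧
      stairY a b c d H k = t := by
  subst hk
  unfold stairX stairY
  rw [if_neg (by omega), if_neg (by omega), if_neg (by omega), if_pos (by omega),
    if_neg (by omega), if_neg (by omega), if_pos (by omega)]
  omega

theorem stair_BR_odd {a b c d H k t : ℕ} (ht : t < d) (hk : k = 2 * (b + c) + 4 + 2 * t) :
    stairX a b c d k = a + b + 1 - d + t ∧
      stairY a b c d H k = t + 1 := by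
  subst hk
  unfold stairX stairY
  rw [if_neg (by omega), if_neg (by omega), if_neg (by omega), if_pos (by omega),
    if_neg (by omega), if_neg (by omega), if_pos (by omega)]
  omega

theorem stair_TR_even {a b c d H k t : ℕ} (hk : k = 2 * (b + c + d) + 4 + 2 * t) :
    stairX a b c d k = a + b + 1 - t ∧
      stairY a b c d H k = H - a + t := by
  subst hk
  unfold stairX stairY
  rw [if_neg (by omega), if_neg (by omega), if_neg (by omega), if_neg (by omega),
    if_neg (by omega), if_neg (by omega), if_neg (by omega)]
  omega

theorem stair_TR_odd {a b c d H k t : ℕ} (hk : k = 2 * (b + c + d) + 5 + 2 * t) :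
    stairX a b c d k = a + b + 1 - t - 1 ∧
      stairY a b c d H k = H - a + t := by
  subst hk
  unfold stairX stairY
  rw [if_neg (by omega), if_neg (by omega), if_neg (by omega), if_neg (by omega),
    if_neg (by omega), if_neg (by omega), if_neg (by omega)]
  omega

theorem stair_zero {a b c d H k : ℕ} (hk : k = 0) :
    stairX a b c d k = b + 1 ∧ stairY a b c d H k = H := by
  simp [hk, stairX, stairY]

/-- The edge with index `k` joins `(x, y)` to `(x', y')`, sorted by the types of edges of the
canonical polygon. -/
def StairStep (a b c d H k : ℕ) (x y x' y' : ℤ) : Prop :=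
  (k = 0 ∧ x = b + 1 ∧ y = H ∧ x' = b ∧ y' = H) ∨
  (∃ t < b, k = 2 * t + 1 ∧ x = b - t ∧ y = H - t ∧ x' = b - t ∧ y' = H - t - 1) ∨
  (∃ t < b, k = 2 * t + 2 ∧ x = b - t ∧ y = H - t - 1 ∧ x' = b - t - 1 ∧ y' = H - t - 1) ∨
  (k = 2 * b + 1 ∧ x = 0 ∧ y = H - b ∧ x' = 0 ∧ y' = c) ∨
  (∃ t < c, k = 2 * b + 2 + 2 * t ∧ x = t ∧ y = c - t ∧ x' = t + 1 ∧ y' = c - t) ∨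
  (∃ t < c, k = 2 * b + 3 + 2 * t ∧ x = t + 1 ∧ y = c - t ∧ x' = t + 1 ∧ y' = c - t - 1) ∨
  (k = 2 * (b + c) + 2 ∧ x = c ∧ y = 0 ∧ x' = a + b + 1 - d ∧ y' = 0) ∨
  (∃ t < d, k = 2 * (b + c) + 3 + 2 * t ∧ x = a + b + 1 - d + t ∧ y = t ∧
    x' = a + b + 1 - d + t ∧ y' = t + 1) ∨
  (∃ t < d, k = 2 * (b + c) + 4 + 2 * t ∧ x = a + b + 1 - d + t ∧ y = t + 1 ∧
    x' = a + b + 1 - d + t + 1 ∧ y' = t + 1) ∨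
  (k = 2 * (b + c + d) + 3 ∧ x = a + b + 1 ∧ y = d ∧ x' = a + b + 1 ∧ y' = H - a) ∨
  (∃ t < a, k = 2 * (b + c + d) + 4 + 2 * t ∧ x = a + b + 1 - t ∧ y = H - a + t ∧
    x' = a + b + 1 - t - 1 ∧ y' = H - a + t) ∨
  (∃ t < a, k = 2 * (b + c + d) + 5 + 2 * t ∧ x = a + b + 1 - t - 1 ∧ y = H - a + t ∧
    x' = a + b + 1 - t - 1 ∧ y' = H - a + t + 1)

/-- The classification of the edges of the canonical polygon by their indices. -/
theorem stair_index_cases (a b c d k : ℕ) (hk : k < 2 * (a + b + c + d) + 4) :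
    k = 0 ∨ (∃ t < b, k = 2 * t + 1) ∨ (∃ t < b, k = 2 * t + 2) ∨ k = 2 * b + 1 ∨
    (∃ t < c, k = 2 * b + 2 + 2 * t) ∨ (∃ t < c, k = 2 * b + 3 + 2 * t) ∨
    k = 2 * (b + c) + 2 ∨
    (∃ t < d, k = 2 * (b + c) + 3 + 2 * t) ∨ (∃ t < d, k = 2 * (b + c) + 4 + 2 * t) ∨
    k = 2 * (b + c + d) + 3 ∨
    (∃ t < a, k = 2 * (b + c + d) + 4 + 2 * t) ∨
    (∃ t < a, k = 2 * (b + c + d) + 5 + 2 * t) := by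
  rcases Nat.even_or_odd' k with ⟨s, rfl | rfl⟩
  · by_cases h1 : s ≤ b
    · by_cases h0 : s = 0
      · omega
      · exact .inr <| .inr <| .inl ⟨s - 1, by omega, by omega⟩
    by_cases h2 : s ≤ b + c
    · exact .inr <| .inr <| .inr <| .inr <| .inl ⟨s - b - 1, by omega, by omega⟩
    by_cases h3 : s = b + c + 1
    · omega
    by_cases h4 : s ≤ b + c + d + 1
    · iterate 8 right
      left
      exact ⟨s - (b + c) - 2, by omega, by omega⟩
    · iterate 10 right
      left
      exact ⟨s - (b + c + d) - 2, by omega, by omega⟩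
  · by_cases h1 : s < b
    · exact .inr <| .inl ⟨s, by omega, by omega⟩
    by_cases h2 : s = b
    · omega
    by_cases h3 : s ≤ b + c
    · iterate 5 right
      left
      exact ⟨s - b - 1, by omega, by omega⟩
    by_cases h4 : s ≤ b + c + d
    · iterate 7 right
      left
      exact ⟨s - (b + c) - 1, by omega, by omega⟩
    by_cases h5 : s = b + c + d + 1
    · omega
    · iterate 11 right
      exact ⟨s - (b + c + d) - 2, by omega, by omega⟩

theorem stairStep (a b c d H k : ℕ) (hk : k < 2 * (a + b + c + d) + 4) :
    StairStep a b c d H k (stairX a b c d k) (stairY a b c d H k)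
      (stairX a b c d (k + 1)) (stairY a b c d H (k + 1)) := by
  rcases stair_index_cases a b c d k hk with h | ⟨t, ht, h⟩ | ⟨t, ht, h⟩ | h | ⟨t, ht, h⟩ |
    ⟨t, ht, h⟩ | h | ⟨t, ht, h⟩ | ⟨t, ht, h⟩ | h | ⟨t, ht, h⟩ | ⟨t, ht, h⟩
  · have e1 : stairX a b c d k = _ ∧ stairY a b c d H k = _ := stair_zero (by omega)
    have e2 : stairX a b c d (k + 1) = _ ∧ stairY a b c d H (k + 1) = _ :=
      stair_TL_even (t := 0) (Nat.zero_le b) (by omega)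
    left
    omega
  · have e1 : stairX a b c d k = _ ∧ stairY a b c d H k = _ := stair_TL_even ht.le (by omega)
    have e2 : stairX a b c d (k + 1) = _ ∧ stairY a b c d H (k + 1) = _ :=
      stair_TL_odd ht (by omega)
    right
    left
    exact ⟨t, ht, by omega⟩
  · have e1 : stairX a b c d k = _ ∧ stairY a b c d H k = _ := stair_TL_odd ht (by omega)
    have e2 : stairX a b c d (k + 1) = _ ∧ stairY a b c d H (k + 1) = _ :=
      stair_TL_even (Nat.succ_le_of_lt ht) (by omega)
    iterate 2 right
    left
    exact ⟨t, ht, by omega⟩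
  · have e1 : stairX a b c d k = _ ∧ stairY a b c d H k = _ := stair_TL_even le_rfl (by omega)
    have e2 : stairX a b c d (k + 1) = _ ∧ stairY a b c d H (k + 1) = _ :=
      stair_BL_even (t := 0) (Nat.zero_le c) (by omega)
    iterate 3 right
    left
    omega
  · have e1 : stairX a b c d k = _ ∧ stairY a b c d H k = _ := stair_BL_even ht.le (by omega)
    have e2 : stairX a b c d (k + 1) = _ ∧ stairY a b c d H (k + 1) = _ :=
      stair_BL_odd ht (by omega)
    iterate 4 right
    left
    exact ⟨t, ht, by omega⟩
  · have e1 : stairX a b c d k = _ ∧ stairY a b c d H k = _ := stair_BL_odd ht (by omega)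
    have e2 : stairX a b c d (k + 1) = _ ∧ stairY a b c d H (k + 1) = _ :=
      stair_BL_even (Nat.succ_le_of_lt ht) (by omega)
    iterate 5 right
    left
    exact ⟨t, ht, by omega⟩
  · have e1 : stairX a b c d k = _ ∧ stairY a b c d H k = _ := stair_BL_even le_rfl (by omega)
    have e2 : stairX a b c d (k + 1) = _ ∧ stairY a b c d H (k + 1) = _ :=
      stair_BR_even (t := 0) (Nat.zero_le d) (by omega)
    iterate 6 right
    left
    omega
  · have e1 : stairX a b c d k = _ ∧ stairY a b c d H k = _ := stair_BR_even ht.le (by omega)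
    have e2 : stairX a b c d (k + 1) = _ ∧ stairY a b c d H (k + 1) = _ :=
      stair_BR_odd ht (by omega)
    iterate 7 right
    left
    exact ⟨t, ht, by omega⟩
  · have e1 : stairX a b c d k = _ ∧ stairY a b c d H k = _ := stair_BR_odd ht (by omega)
    have e2 : stairX a b c d (k + 1) = _ ∧ stairY a b c d H (k + 1) = _ :=
      stair_BR_even (Nat.succ_le_of_lt ht) (by omega)
    iterate 8 right
    left
    exact ⟨t, ht, by omega⟩
  · have e1 : stairX a b c d k = _ ∧ stairY a b c d H k = _ := stair_BR_even le_rfl (by omega)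
    have e2 : stairX a b c d (k + 1) = _ ∧ stairY a b c d H (k + 1) = _ :=
      stair_TR_even (t := 0) (by omega)
    iterate 9 right
    left
    omega
  · have e1 : stairX a b c d k = _ ∧ stairY a b c d H k = _ := stair_TR_even (t := t) (by omega)
    have e2 : stairX a b c d (k + 1) = _ ∧ stairY a b c d H (k + 1) = _ :=
      stair_TR_odd (t := t) (by omega)
    iterate 10 right
    left
    exact ⟨t, ht, by omega⟩
  · have e1 : stairX a b c d k = _ ∧ stairY a b c d H k = _ := stair_TR_odd (t := t) (by omega)
    have e2 : stairX a b c d (k + 1) = _ ∧ stairY a b c d H (k + 1) = _ :=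
      stair_TR_even (t := t + 1) (by omega)
    iterate 11 right
    exact ⟨t, ht, by omega⟩

/-- The types of edges of the canonical polygon, as linear constraints on the points `(x, y)`
of the edge with index `k`. -/
def StairEdge (a b c d H k : ℕ) (x y : ℤ) : Prop :=
  (k = 0 ∧ y = H ∧ b ≤ x ∧ x ≤ b + 1) ∨
  (∃ t < b, k = 2 * t + 1 ∧ x = b - t ∧ H - t - 1 ≤ y ∧ y ≤ H - t) ∨
  (∃ t < b, k = 2 * t + 2 ∧ y = H - t - 1 ∧ b - t - 1 ≤ x ∧ x ≤ b - t) ∨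
  (k = 2 * b + 1 ∧ x = 0 ∧ c ≤ y ∧ y ≤ H - b) ∨
  (∃ t < c, k = 2 * b + 2 + 2 * t ∧ y = c - t ∧ t ≤ x ∧ x ≤ t + 1) ∨
  (∃ t < c, k = 2 * b + 3 + 2 * t ∧ x = t + 1 ∧ c - t - 1 ≤ y ∧ y ≤ c - t) ∨
  (k = 2 * (b + c) + 2 ∧ y = 0 ∧ c ≤ x ∧ x ≤ a + b + 1 - d) ∨
  (∃ t < d, k = 2 * (b + c) + 3 + 2 * t ∧ x = a + b + 1 - d + t ∧ t ≤ y ∧ y ≤ t + 1) ∨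
  (∃ t < d, k = 2 * (b + c) + 4 + 2 * t ∧ y = t + 1 ∧
    a + b + 1 - d + t ≤ x ∧ x ≤ a + b + 1 - d + t + 1) ∨
  (k = 2 * (b + c + d) + 3 ∧ x = a + b + 1 ∧ d ≤ y ∧ y ≤ H - a) ∨
  (∃ t < a, k = 2 * (b + c + d) + 4 + 2 * t ∧ y = H - a + t ∧
    a + b + 1 - t - 1 ≤ x ∧ x ≤ a + b + 1 - t) ∨
  (∃ t < a, k = 2 * (b + c + d) + 5 + 2 * t ∧ x = a + b + 1 - t - 1 ∧
    H - a + t ≤ y ∧ y ≤ H - a + t + 1)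

theorem StairStep.stairEdge {a b c d H k : ℕ} (hW : c + d ≤ a + b) (hL : b + c < H)
    (hR : a + d < H) {x y x' y' : ℤ} (h : StairStep a b c d H k x y x' y') {p : ℤ × ℤ}
    (hp : onSeg (x, y) (x', y') p) : StairEdge a b c d H k p.1 p.2 := by
  obtain ⟨h1, h2, h3, h4⟩ := hp
  simp only at h1 h2 h3 h4
  rcases h with h | ⟨t, ht, h⟩ | ⟨t, ht, h⟩ | h | ⟨t, ht, h⟩ |
    ⟨t, ht, h⟩ | h | ⟨t, ht, h⟩ | ⟨t, ht, h⟩ | h | ⟨t, ht, h⟩ | ⟨t, ht, h⟩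
  · left
    omega
  · right
    left
    exact ⟨t, ht, by omega⟩
  · iterate 2 right
    left
    exact ⟨t, ht, by omega⟩
  · iterate 3 right
    left
    omega
  · iterate 4 right
    left
    exact ⟨t, ht, by omega⟩
  · iterate 5 right
    left
    exact ⟨t, ht, by omega⟩
  · iterate 6 right
    left
    omega
  · iterate 7 right
    left
    exact ⟨t, ht, by omega⟩
  · iterate 8 right
    left
    exact ⟨t, ht, by omega⟩
  · iterate 9 right
    left
    omega
  · iterate 10 right
    left
    exact ⟨t, ht, by omega⟩
  · iterate 11 right
    exact ⟨t, ht, by omega⟩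

theorem StairStep.horizontal {a b c d H k : ℕ} {x y x' y' : ℤ} (hW : c + d ≤ a + b)
    (h : StairStep a b c d H k x y x' y') (hk : k % 2 = 0) :
    y' = y ∧ ((k ≤ 2 * b ∨ 2 * (b + c + d) + 4 ≤ k) ∧ x' < x ∨
      (2 * b < k ∧ k < 2 * (b + c + d) + 4) ∧ x < x') := by
  rcases h with h | ⟨t, ht, h⟩ | ⟨t, ht, h⟩ | h | ⟨t, ht, h⟩ |
    ⟨t, ht, h⟩ | h | ⟨t, ht, h⟩ | ⟨t, ht, h⟩ | h | ⟨t, ht, h⟩ | ⟨t, ht, h⟩ <;> omega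

theorem StairStep.vertical {a b c d H k : ℕ} {x y x' y' : ℤ} (hL : b + c < H)
    (hR : a + d < H) (h : StairStep a b c d H k x y x' y') (hk : k % 2 = 1) :
    x' = x ∧ (k ≤ 2 * (b + c) + 1 ∧ y' < y ∨ 2 * (b + c) + 1 < k ∧ y < y') := by
  rcases h with h | ⟨t, ht, h⟩ | ⟨t, ht, h⟩ | h | ⟨t, ht, h⟩ |
    ⟨t, ht, h⟩ | h | ⟨t, ht, h⟩ | ⟨t, ht, h⟩ | h | ⟨t, ht, h⟩ | ⟨t, ht, h⟩ <;> omega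

theorem StairStep.length {a b c d H k : ℕ} {x y x' y' : ℤ} (hW : c + d ≤ a + b)
    (hL : b + c < H) (hR : a + d < H) (h : StairStep a b c d H k x y x' y') :
    |x' - x| + |y' - y| = 1 + (if k = 2 * b + 1 then (H - b - c - 1 : ℤ) else 0) +
      (if k = 2 * (b + c) + 2 then (a + b - c - d : ℤ) else 0) +
      (if k = 2 * (b + c + d) + 3 then (H - a - d - 1 : ℤ) else 0) := by
  rw [abs_eq_max_neg, abs_eq_max_neg]
  rcases h with h | ⟨t, ht, h⟩ | ⟨t, ht, h⟩ | h | ⟨t, ht, h⟩ |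
    ⟨t, ht, h⟩ | h | ⟨t, ht, h⟩ | ⟨t, ht, h⟩ | h | ⟨t, ht, h⟩ | ⟨t, ht, h⟩ <;> split_ifs <;> omega

set_option maxHeartbeats 4000000 in
theorem StairEdge.adjacent {a b c d H k l : ℕ} (hW : c + d ≤ a + b) (hL : b + c < H)
    (hR : a + d < H) (h1 : c + 1 < b + H) (h2 : d + 1 < a + H) (hkl : k < l) {x y : ℤ}
    (hk : StairEdge a b c d H k x y) (hl : StairEdge a b c d H l x y) :
    l = k + 1 ∨ k = 0 ∧ l = 2 * (a + b + c + d) + 3 := by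
  rcases hk with h | ⟨t, ht, h⟩ | ⟨t, ht, h⟩ | h | ⟨t, ht, h⟩ |
    ⟨t, ht, h⟩ | h | ⟨t, ht, h⟩ | ⟨t, ht, h⟩ | h | ⟨t, ht, h⟩ | ⟨t, ht, h⟩ <;>
  rcases hl with g | ⟨s, hs, g⟩ | ⟨s, hs, g⟩ | g | ⟨s, hs, g⟩ |
    ⟨s, hs, g⟩ | g | ⟨s, hs, g⟩ | ⟨s, hs, g⟩ | g | ⟨s, hs, g⟩ | ⟨s, hs, g⟩ <;>
  omega

/-- The vertices of the canonical polygon of height `H`. -/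
def stairPt (a b c d H k : ℕ) : ℤ × ℤ := (stairX a b c d k, stairY a b c d H k)

theorem stairPt_last (a b c d H : ℕ) :
    stairPt a b c d H (2 * (a + b + c + d) + 4) = stairPt a b c d H 0 := by
  have h1 := stair_TR_even (a := a) (H := H) (t := a)
    (show 2 * (a + b + c + d) + 4 = 2 * (b + c + d) + 4 + 2 * a by ring)
  have h2 := stair_zero (a := a) (b := b) (c := c) (d := d) (H := H) rfl
  simp only [stairPt, h1, h2, Prod.mk.injEq]
  omega

theorem ZMod.apply_val_natCast {n : ℕ} [NeZero n] {α : Type*} {f : ℕ → α} (hf : f n = f 0) {k : ℕ}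
    (hk : k ≤ n) : f (k : ZMod n).val = f k := by
  rcases hk.lt_or_eq with hk | rfl
  · rw [ZMod.val_cast_of_lt hk]
  · simp [hf]

theorem ZMod.exists_natCast_lt {n : ℕ} [NeZero n] (i : ZMod n) : ∃ k < n, (k : ZMod n) = i :=
  ⟨i.val, i.val_lt, ZMod.natCast_zmod_val i⟩

/-- The canonical polygon of height `H`: apart from three of the extreme edges, all of its edges
have unit length. -/
def stairPolygon (a b c d H : ℕ) (hW : c + d ≤ a + b) (hL : b + c < H) (hR : a + d < H)
    (h1 : c + 1 < b + H) (h2 : d + 1 < a + H) : RectPolygon (2 * (a + b + c + d) + 4) where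
  v i := stairPt a b c d H i.val
  nondeg i := by
    obtain ⟨k, hk, rfl⟩ := ZMod.exists_natCast_lt i
    have hs := stairStep a b c d H k hk
    rw [← Nat.cast_succ, ZMod.apply_val_natCast (stairPt_last a b c d H) hk,
      ZMod.apply_val_natCast (stairPt_last a b c d H) hk.le]
    simp only [stairPt, ne_eq, Prod.mk.injEq, Nat.succ_eq_add_one]
    rcases Nat.mod_two_eq_zero_or_one k with h | h
    · have := hs.horizontal hW h
      omega
    · have := hs.vertical hL hR h
      omega
  axis i := by
    obtain ⟨k, hk, rfl⟩ := ZMod.exists_natCast_lt i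
    have hs := stairStep a b c d H k hk
    rw [← Nat.cast_succ, ZMod.apply_val_natCast (stairPt_last a b c d H) hk,
      ZMod.apply_val_natCast (stairPt_last a b c d H) hk.le]
    rcases Nat.mod_two_eq_zero_or_one k with h | h
    · exact .inr (hs.horizontal hW h).1
    · exact .inl (hs.vertical hL hR h).1
  alt i := by
    have key : ∀ k < 2 * (a + b + c + d) + 4,
        ((stairPt a b c d H (k + 1)).1 = (stairPt a b c d H k).1 ↔ k % 2 = 1) ∧
        ((stairPt a b c d H (k + 1)).2 = (stairPt a b c d H k).2 ↔ k % 2 = 0) := by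
      intro k hk
      have hs := stairStep a b c d H k hk
      simp only [stairPt]
      rcases Nat.mod_two_eq_zero_or_one k with h | h
      · have := hs.horizontal hW h
        omega
      · have := hs.vertical hL hR h
        omega
    rw [show i + 2 = i + 1 + 1 by ring]
    obtain ⟨k, hk, rfl⟩ := ZMod.exists_natCast_lt i
    rw [← Nat.cast_succ, ZMod.apply_val_natCast (stairPt_last a b c d H) hk,
      ZMod.apply_val_natCast (stairPt_last a b c d H) hk.le, Nat.succ_eq_add_one, (key k hk).1]
    rcases (Nat.succ_le_of_lt hk).lt_or_eq with hk' | hk'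
    · rw [← Nat.cast_succ, ZMod.apply_val_natCast (stairPt_last a b c d H) hk',
        Nat.succ_eq_add_one, (key _ hk').2]
      omega
    · have h01 : ((k + 1 : ℕ) : ZMod (2 * (a + b + c + d) + 4)) + 1 = ((1 : ℕ) : ZMod _) := by
        rw [show k + 1 = _ from hk', ZMod.natCast_self, zero_add, Nat.cast_one]
      rw [h01, ZMod.apply_val_natCast (stairPt_last a b c d H) (by omega),
        ← Nat.succ_eq_add_one, hk', stairPt_last, ← zero_add 1, (key 0 (by omega)).2]
      omega
  simple := by
    have key : ∀ k l, k < l → l < 2 * (a + b + c + d) + 4 → ∀ p : ℤ × ℤ,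
        onSeg (stairPt a b c d H k) (stairPt a b c d H (k + 1)) p →
        onSeg (stairPt a b c d H l) (stairPt a b c d H (l + 1)) p →
        (l = k + 1 ∧ p = stairPt a b c d H l) ∨
          (k = 0 ∧ l + 1 = 2 * (a + b + c + d) + 4 ∧ p = stairPt a b c d H k) := by
      intro k l hkl hl p hp hq
      have hs := stairStep a b c d H k (hkl.trans hl)
      have hs' := stairStep a b c d H l hl
      have hlast : stairPt a b c d H (2 * (a + b + c + d) + 3 + 1) = _ := stairPt_last a b c d H
      have hadj := (hs.stairEdge hW hL hR hp).adjacent hW hL hR h1 h2 hkl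
        (hs'.stairEdge hW hL hR hq)
      obtain ⟨p1, p2, p3, p4⟩ := hp
      obtain ⟨q1, q2, q3, q4⟩ := hq
      simp only [stairPt, Prod.ext_iff] at *
      rcases hadj with rfl | ⟨rfl, rfl⟩
      · rcases Nat.mod_two_eq_zero_or_one k with h | h
        · have := hs.horizontal hW h
          have := hs'.vertical hL hR (by omega)
          omega
        · have := hs.vertical hL hR h
          have := hs'.horizontal hW (by omega)
          omega
      · have := hs.horizontal hW rfl
        have := hs'.vertical hL hR (by omega)
        omega
    intro i j hij p hp hq
    obtain ⟨k, hk, rfl⟩ := ZMod.exists_natCast_lt i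
    obtain ⟨l, hl, rfl⟩ := ZMod.exists_natCast_lt j
    rw [← Nat.cast_succ, ZMod.apply_val_natCast (stairPt_last a b c d H) hk,
      ZMod.apply_val_natCast (stairPt_last a b c d H) hk.le] at hp
    rw [← Nat.cast_succ, ZMod.apply_val_natCast (stairPt_last a b c d H) hl,
      ZMod.apply_val_natCast (stairPt_last a b c d H) hl.le] at hq
    rw [ZMod.apply_val_natCast (stairPt_last a b c d H) hk.le,
      ZMod.apply_val_natCast (stairPt_last a b c d H) hl.le]
    have hne : l ≠ k := fun h => hij (by rw [h])
    rcases hne.lt_or_gt with h | h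
    · rcases key l k h hk p hq hp with ⟨rfl, h'⟩ | ⟨rfl, hk', h'⟩
      · exact .inr ⟨by push_cast; rfl, h'⟩
      · refine .inl ⟨?_, h'⟩
        rw [← Nat.cast_succ, Nat.succ_eq_add_one, hk', ZMod.natCast_self, Nat.cast_zero]
    · rcases key k l h hl p hp hq with ⟨rfl, h'⟩ | ⟨rfl, hk', h'⟩
      · exact .inl ⟨by push_cast; rfl, h'⟩
      · refine .inr ⟨?_, h'⟩
        rw [← Nat.cast_succ, Nat.succ_eq_add_one, hk', ZMod.natCast_self, Nat.cast_zero]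

theorem Finset.sum_range_add_two_mul {g : ℕ → ℤ} {s m : ℕ} {C : ℤ}
    (h : ∀ t < m, g (s + 2 * t) + g (s + 2 * t + 1) = C) :
    ∑ k ∈ Finset.range (s + 2 * m), g k = ∑ k ∈ Finset.range s, g k + m * C := by
  induction m with
  | zero => simp
  | succ m ih =>
    rw [show s + 2 * (m + 1) = s + 2 * m + 1 + 1 by ring, Finset.sum_range_succ,
      Finset.sum_range_succ, ih fun t ht => h t (ht.trans m.lt_succ_self)]
    have := h m m.lt_succ_self
    push_cast
    linarith

theorem sum_cross_stairPt (a b c d H : ℕ) :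
    ∑ k ∈ Finset.range (2 * (a + b + c + d) + 4),
      cross (stairPt a b c d H k) (stairPt a b c d H (k + 1)) =
      2 * ((a + b + 1) * H) - (a * (a + 1) + b * (b + 1) + c * (c + 1) + d * (d + 1)) := by
  rw [show 2 * (a + b + c + d) + 4 = 2 * (b + c + d) + 4 + 2 * a by ring,
    Finset.sum_range_add_two_mul (C := H + (a + b + 1) - a - 1),
    show 2 * (b + c + d) + 4 = 2 * (b + c) + 3 + 2 * d + 1 by ring, Finset.sum_range_succ,
    Finset.sum_range_add_two_mul (C := a + b + 1 - d - 1),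
    show 2 * (b + c) + 3 = 2 * b + 2 + 2 * c + 1 by ring, Finset.sum_range_succ,
    Finset.sum_range_add_two_mul (C := - (c + 1)),
    show 2 * b + 2 = 1 + 2 * b + 1 by ring, Finset.sum_range_succ,
    Finset.sum_range_add_two_mul (C := H - 1 - b), Finset.sum_range_one]
  · simp only [stairPt, cross]
    rw [(stair_zero (H := H) rfl).1, (stair_zero (H := H) rfl).2,
      (stair_TL_even (H := H) (t := 0) (Nat.zero_le b) rfl).1,
      (stair_TL_even (H := H) (t := 0) (Nat.zero_le b) rfl).2,
      (stair_TL_even (H := H) (k := 1 + 2 * b) le_rfl (by ring)).1,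
      (stair_TL_even (H := H) (k := 1 + 2 * b) le_rfl (by ring)).2,
      (stair_BL_even (H := H) (k := 1 + 2 * b + 1) (t := 0) (Nat.zero_le c) (by ring)).1,
      (stair_BL_even (H := H) (k := 1 + 2 * b + 1) (t := 0) (Nat.zero_le c) (by ring)).2,
      (stair_BL_even (H := H) (k := 1 + 2 * b + 1 + 2 * c) le_rfl (by ring)).1,
      (stair_BL_even (H := H) (k := 1 + 2 * b + 1 + 2 * c) le_rfl (by ring)).2,
      (stair_BR_even (H := H) (k := 1 + 2 * b + 1 + 2 * c + 1) (t := 0) (Nat.zero_le d)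
        (by ring)).1,
      (stair_BR_even (H := H) (k := 1 + 2 * b + 1 + 2 * c + 1) (t := 0) (Nat.zero_le d)
        (by ring)).2,
      (stair_BR_even (H := H) (k := 1 + 2 * b + 1 + 2 * c + 1 + 2 * d) le_rfl (by ring)).1,
      (stair_BR_even (H := H) (k := 1 + 2 * b + 1 + 2 * c + 1 + 2 * d) le_rfl (by ring)).2,
      (stair_TR_even (H := H) (k := 1 + 2 * b + 1 + 2 * c + 1 + 2 * d + 1) (t := 0) (by ring)).1,
      (stair_TR_even (H := H) (k := 1 + 2 * b + 1 + 2 * c + 1 + 2 * d + 1) (t := 0) (by ring)).2]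
    push_cast
    ring
  · intro t ht
    have e1 : stairX a b c d (1 + 2 * t) = _ ∧ stairY a b c d H (1 + 2 * t) = _ :=
      stair_TL_even ht.le (by ring)
    have e2 : stairX a b c d (1 + 2 * t + 1) = _ ∧ stairY a b c d H (1 + 2 * t + 1) = _ :=
      stair_TL_odd ht (by ring)
    have e3 : stairX a b c d (1 + 2 * t + 1 + 1) = _ ∧ stairY a b c d H (1 + 2 * t + 1 + 1) = _ :=
      stair_TL_even (Nat.succ_le_of_lt ht) (by rw [Nat.succ_eq_add_one]; ring)
    simp only [stairPt, cross, e1, e2, e3]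
    push_cast
    ring
  · intro t ht
    have e1 : stairX a b c d (2 * b + 2 + 2 * t) = _ ∧
      stairY a b c d H (2 * b + 2 + 2 * t) = _ := stair_BL_even ht.le rfl
    have e2 : stairX a b c d (2 * b + 2 + 2 * t + 1) = _ ∧
      stairY a b c d H (2 * b + 2 + 2 * t + 1) = _ := stair_BL_odd ht (by ring)
    have e3 : stairX a b c d (2 * b + 2 + 2 * t + 1 + 1) = _ ∧
      stairY a b c d H (2 * b + 2 + 2 * t + 1 + 1) = _ :=
      stair_BL_even (Nat.succ_le_of_lt ht) (by rw [Nat.succ_eq_add_one]; ring)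
    simp only [stairPt, cross, e1, e2, e3]
    push_cast
    ring
  · intro t ht
    have e1 : stairX a b c d (2 * (b + c) + 3 + 2 * t) = _ ∧
      stairY a b c d H (2 * (b + c) + 3 + 2 * t) = _ := stair_BR_even ht.le rfl
    have e2 : stairX a b c d (2 * (b + c) + 3 + 2 * t + 1) = _ ∧
      stairY a b c d H (2 * (b + c) + 3 + 2 * t + 1) = _ := stair_BR_odd ht (by ring)
    have e3 : stairX a b c d (2 * (b + c) + 3 + 2 * t + 1 + 1) = _ ∧
      stairY a b c d H (2 * (b + c) + 3 + 2 * t + 1 + 1) = _ :=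
      stair_BR_even (Nat.succ_le_of_lt ht) (by rw [Nat.succ_eq_add_one]; ring)
    simp only [stairPt, cross, e1, e2, e3]
    push_cast
    ring
  · intro t ht
    have e1 : stairX a b c d (2 * (b + c + d) + 4 + 2 * t) = _ ∧
      stairY a b c d H (2 * (b + c + d) + 4 + 2 * t) = _ := stair_TR_even rfl
    have e2 : stairX a b c d (2 * (b + c + d) + 4 + 2 * t + 1) = _ ∧
      stairY a b c d H (2 * (b + c + d) + 4 + 2 * t + 1) = _ := stair_TR_odd (t := t) (by ring)
    have e3 : stairX a b c d (2 * (b + c + d) + 4 + 2 * t + 1 + 1) = _ ∧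
      stairY a b c d H (2 * (b + c + d) + 4 + 2 * t + 1 + 1) = _ :=
      stair_TR_even (t := t + 1) (by ring)
    simp only [stairPt, cross, e1, e2, e3]
    push_cast
    ring

theorem sum_cross_stairPt_pos {a b c d H : ℕ} (hW : c + d ≤ a + b) (hL : b + c < H)
    (hR : a + d < H) :
    0 < ∑ k ∈ Finset.range (2 * (a + b + c + d) + 4),
      cross (stairPt a b c d H k) (stairPt a b c d H (k + 1)) := by
  rw [sum_cross_stairPt]
  zify at hW hL hR
  have ha : (a : ℤ) * (a + 1) ≤ a * H := by gcongr; omega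
  have hb : (b : ℤ) * (b + 1) ≤ b * H := by gcongr; omega
  have hc : (c : ℤ) * (c + 1) ≤ c * H := by gcongr; omega
  have hd : (d : ℤ) * (d + 1) ≤ d * H := by gcongr; omega
  have : ((c : ℤ) + d) * H ≤ (a + b) * H := by gcongr
  have : (0 : ℤ) < H := by omega
  linarith

theorem stairPolygon_dvec {a b c d H : ℕ} (hW : c + d ≤ a + b) (hL : b + c < H)
    (hR : a + d < H) (h1 : c + 1 < b + H) (h2 : d + 1 < a + H) {k : ℕ}
    (hk : k < 2 * (a + b + c + d) + 4) :
    (stairPolygon a b c d H hW hL hR h1 h2).dvec k =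
      (stairX a b c d (k + 1) - stairX a b c d k, stairY a b c d H (k + 1) - stairY a b c d H k) := by
  simp only [RectPolygon.dvec, stairPolygon]
  rw [← Nat.cast_succ, ZMod.apply_val_natCast (stairPt_last a b c d H) hk,
    ZMod.apply_val_natCast (stairPt_last a b c d H) hk.le]
  rfl

theorem ZMod.natCast_sub_one {n : ℕ} [NeZero n] (k : ℕ) :
    (k : ZMod n) - 1 = ((if k = 0 then n - 1 else k - 1 : ℕ) : ZMod n) := by
  split_ifs with h
  · subst h
    rw [Nat.cast_sub (NeZero.one_le), ZMod.natCast_self]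
    simp
  · rw [Nat.cast_sub (Nat.one_le_iff_ne_zero.mpr h), Nat.cast_one]

theorem stairPolygon_turn {a b c d H : ℕ} (hW : c + d ≤ a + b) (hL : b + c < H)
    (hR : a + d < H) (h1 : c + 1 < b + H) (h2 : d + 1 < a + H) {k : ℕ}
    (hk : k < 2 * (a + b + c + d) + 4) :
    (IsLeftTurn b c d k → (stairPolygon a b c d H hW hL hR h1 h2).convexAt k) ∧
      (¬ IsLeftTurn b c d k → (stairPolygon a b c d H hW hL hR h1 h2).reflexAt k) := by
  unfold RectPolygon.convexAt RectPolygon.reflexAt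
  rw [ZMod.natCast_sub_one, stairPolygon_dvec hW hL hR h1 h2 hk]
  have hl : (if k = 0 then 2 * (a + b + c + d) + 4 - 1 else k - 1) < 2 * (a + b + c + d) + 4 := by
    split_ifs <;> omega
  rw [stairPolygon_dvec hW hL hR h1 h2 hl]
  have hs := stairStep a b c d H k hk
  have hs' := stairStep a b c d H _ hl
  have hkl : (k = 0 ∧ (if k = 0 then 2 * (a + b + c + d) + 4 - 1 else k - 1) =
      2 * (a + b + c + d) + 3) ∨ k = (if k = 0 then 2 * (a + b + c + d) + 4 - 1 else k - 1) + 1 := by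
    split_ifs <;> omega
  generalize (if k = 0 then 2 * (a + b + c + d) + 4 - 1 else k - 1) = l at hl hs' hkl ⊢
  simp only [cross, IsLeftTurn]
  rcases Nat.mod_two_eq_zero_or_one k with h | h
  · obtain ⟨e1, e2⟩ := hs.horizontal hW h
    obtain ⟨e3, e4⟩ := hs'.vertical hL hR (by omega)
    rw [e1, e3, sub_self, sub_self, zero_mul, zero_sub, neg_pos, neg_lt_zero]
    constructor
    · intro hI
      rcases e2 with ⟨_, e2⟩ | ⟨_, e2⟩ <;> rcases e4 with ⟨_, e4⟩ | ⟨_, e4⟩ <;>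
        first
        | exact mul_neg_of_pos_of_neg (by linarith) (by linarith)
        | exact mul_neg_of_neg_of_pos (by linarith) (by linarith)
        | omega
    · intro hI
      rcases e2 with ⟨_, e2⟩ | ⟨_, e2⟩ <;> rcases e4 with ⟨_, e4⟩ | ⟨_, e4⟩ <;>
        first
        | exact mul_pos (by linarith) (by linarith)
        | exact mul_pos_of_neg_of_neg (by linarith) (by linarith)
        | omega
  · obtain ⟨e1, e2⟩ := hs.vertical hL hR h
    obtain ⟨e3, e4⟩ := hs'.horizontal hW (by omega)
    rw [e1, e3, sub_self, sub_self, zero_mul, sub_zero]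
    constructor
    · intro hI
      rcases e2 with ⟨_, e2⟩ | ⟨_, e2⟩ <;> rcases e4 with ⟨_, e4⟩ | ⟨_, e4⟩ <;>
        first
        | exact mul_pos (by linarith) (by linarith)
        | exact mul_pos_of_neg_of_neg (by linarith) (by linarith)
        | omega
    · intro hI
      rcases e2 with ⟨_, e2⟩ | ⟨_, e2⟩ <;> rcases e4 with ⟨_, e4⟩ | ⟨_, e4⟩ <;>
        first
        | exact mul_neg_of_pos_of_neg (by linarith) (by linarith)
        | exact mul_neg_of_neg_of_pos (by linarith) (by linarith)
        | omega

theorem stairPolygon_realizes {a b c d H : ℕ} (hW : c + d ≤ a + b) (hL : b + c < H)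
    (hR : a + d < H) (h1 : c + 1 < b + H) (h2 : d + 1 < a + H) :
    realizes (xySeq b c d a) (stairPolygon a b c d H hW hL hR h1 h2) := by
  refine ⟨(length_xySeq b c d a).symm, ?_, fun i => ?_⟩
  · unfold RectPolygon.ccw
    rw [ZMod.sum_eq_sum_range]
    refine (sum_cross_stairPt_pos hW hL hR).trans_eq (Finset.sum_congr rfl fun k hk => ?_)
    rw [Finset.mem_range] at hk
    simp only [stairPolygon]
    rw [← Nat.cast_succ, ZMod.apply_val_natCast (stairPt_last a b c d H) hk,
      ZMod.apply_val_natCast (stairPt_last a b c d H) hk.le]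
  · have hi := i.isLt.trans_eq (length_xySeq b c d a)
    have ht := stairPolygon_turn hW hL hR h1 h2 hi
    rw [← Bool.not_eq_true, xySeq_get_eq_true_iff]
    by_cases hI : IsLeftTurn b c d i
    · exact ⟨iff_of_true hI (ht.1 hI),
        iff_of_false (not_not.mpr hI) fun h => lt_asymm h (ht.1 hI)⟩
    · exact ⟨iff_of_false hI fun h => lt_asymm h (ht.2 hI), iff_of_true hI (ht.2 hI)⟩

theorem stairPolygon_perimeter {a b c d H : ℕ} (hW : c + d ≤ a + b) (hL : b + c < H)
    (hR : a + d < H) (h1 : c + 1 < b + H) (h2 : d + 1 < a + H) :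
    (stairPolygon a b c d H hW hL hR h1 h2).perimeter = 2 * (a + b + 1) + 2 * H := by
  have h : ∀ k ∈ Finset.range (2 * (a + b + c + d) + 4),
      (stairPolygon a b c d H hW hL hR h1 h2).elen k =
      1 + (if k = 2 * b + 1 then (H - b - c - 1 : ℤ) else 0) +
      (if k = 2 * (b + c) + 2 then (a + b - c - d : ℤ) else 0) +
      (if k = 2 * (b + c + d) + 3 then (H - a - d - 1 : ℤ) else 0) := by
    intro k hk
    rw [Finset.mem_range] at hk
    rw [← (stairStep a b c d H k hk).length hW hL hR]
    have := stairPolygon_dvec hW hL hR h1 h2 hk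
    rw [RectPolygon.dvec, Prod.ext_iff] at this
    unfold RectPolygon.elen
    rw [← Prod.fst_sub, ← Prod.snd_sub, this.1, this.2]
  unfold RectPolygon.perimeter
  rw [ZMod.sum_eq_sum_range, Finset.sum_congr rfl h]
  simp only [Finset.sum_add_distrib, Finset.sum_ite_eq', Finset.mem_range]
  rw [if_pos (by omega), if_pos (by omega), if_pos (by omega)]
  simp
  ring

/-- The signs of the coordinates of the edge vectors, in a frame in which the edge with index `0`
points in the positive direction of the first axis. -/
theorem turn_directions {a b c d : ℕ} {A B : ℕ → ℤ}
    (hAB : ∀ k < 2 * (a + b + c + d) + 4, A k = 0 ∨ B k = 0) (hA : 0 < A 0) (hB : B 0 = 0)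
    (hleft : ∀ k, k + 1 < 2 * (a + b + c + d) + 4 → IsLeftTurn b c d (k + 1) →
      0 < A k * B (k + 1) - B k * A (k + 1))
    (hright : ∀ k, k + 1 < 2 * (a + b + c + d) + 4 → ¬ IsLeftTurn b c d (k + 1) →
      A k * B (k + 1) - B k * A (k + 1) < 0) {k : ℕ} (hk : k < 2 * (a + b + c + d) + 4) :
    (k % 2 = 0 → B k = 0 ∧ ((k ≤ 2 * b ∨ 2 * (b + c + d) + 4 ≤ k) ∧ 0 < A k ∨
      (2 * b < k ∧ k < 2 * (b + c + d) + 4) ∧ A k < 0)) ∧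
    (k % 2 = 1 → A k = 0 ∧ (k ≤ 2 * (b + c) + 1 ∧ 0 < B k ∨ 2 * (b + c) + 1 < k ∧ B k < 0)) := by
  induction k with
  | zero => exact ⟨fun _ => ⟨hB, .inl ⟨.inl (Nat.zero_le _), hA⟩⟩, by simp⟩
  | succ k ih =>
    specialize ih (Nat.lt_of_succ_lt hk)
    have hl := hleft k hk
    have hr := hright k hk
    have hax := hAB (k + 1) hk
    by_cases hI : IsLeftTurn b c d (k + 1)
    · replace hl := hl hI
      clear hr
      rw [IsLeftTurn] at hI
      rcases Nat.mod_two_eq_zero_or_one k with h | h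
      · obtain ⟨h0, h1⟩ := ih.1 h
        rw [h0, zero_mul, sub_zero] at hl
        have hne : B (k + 1) ≠ 0 := right_ne_zero_of_mul hl.ne'
        refine ⟨by omega, fun _ => ⟨by tauto, ?_⟩⟩
        rcases h1 with ⟨_, h1⟩ | ⟨_, h1⟩
        · have := pos_of_mul_pos_right hl h1.le
          omega
        · have := neg_of_mul_pos_right hl h1.le
          omega
      · obtain ⟨h0, h1⟩ := ih.2 h
        rw [h0, zero_mul, zero_sub, neg_pos] at hl
        have hne : A (k + 1) ≠ 0 := right_ne_zero_of_mul hl.ne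
        refine ⟨fun _ => ⟨by tauto, ?_⟩, by omega⟩
        rcases h1 with ⟨_, h1⟩ | ⟨_, h1⟩
        · have : A (k + 1) < 0 := by nlinarith
          omega
        · have : 0 < A (k + 1) := by nlinarith
          omega
    · replace hr := hr hI
      clear hl
      rw [IsLeftTurn] at hI
      rcases Nat.mod_two_eq_zero_or_one k with h | h
      · obtain ⟨h0, h1⟩ := ih.1 h
        rw [h0, zero_mul, sub_zero] at hr
        have hne : B (k + 1) ≠ 0 := right_ne_zero_of_mul hr.ne
        refine ⟨by omega, fun _ => ⟨by tauto, ?_⟩⟩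
        rcases h1 with ⟨_, h1⟩ | ⟨_, h1⟩
        · have : B (k + 1) < 0 := by nlinarith
          omega
        · have : 0 < B (k + 1) := by nlinarith
          omega
      · obtain ⟨h0, h1⟩ := ih.2 h
        rw [h0, zero_mul, zero_sub, neg_lt_zero] at hr
        have hne : A (k + 1) ≠ 0 := right_ne_zero_of_mul hr.ne'
        refine ⟨fun _ => ⟨by tauto, ?_⟩, by omega⟩
        rcases h1 with ⟨_, h1⟩ | ⟨_, h1⟩
        · have : 0 < A (k + 1) := by nlinarith
          omega
        · have : A (k + 1) < 0 := by nlinarith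
          omega

theorem Finset.two_mul_le_sum_range {g : ℕ → ℤ} {s u v w : ℕ} (hs : s < 2) (hg : ∀ k, 0 ≤ g k)
    (hu : ∀ j < u, 2 ≤ g (2 * j + s)) (hw : ∀ j < w, 2 ≤ g (2 * (u + v + j) + s)) :
    2 * (u + w : ℤ) ≤ ∑ k ∈ Finset.range (2 * (u + v + w)), g k := by
  have hsum : ∀ m, ∑ j ∈ Finset.range m, g (2 * j + s) ≤ ∑ k ∈ Finset.range (2 * m), g k := by
    intro m
    induction m with
    | zero => simp
    | succ m ih =>
      rw [mul_add, mul_one, Finset.sum_range_succ, Finset.sum_range_succ, Finset.sum_range_succ]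
      have h0 := hg (2 * m)
      have h1 := hg (2 * m + 1)
      interval_cases s
      · simp only [add_zero] at ih ⊢
        linarith
      · linarith
  refine le_trans ?_ (hsum _)
  rw [Finset.sum_range_add, Finset.sum_range_add]
  have h1 : 2 * (u : ℤ) ≤ ∑ j ∈ Finset.range u, g (2 * j + s) := by
    simpa [mul_comm] using Finset.card_nsmul_le_sum (Finset.range u) (fun j => g (2 * j + s)) 2
      (by simpa using hu)
  have h2 : 0 ≤ ∑ j ∈ Finset.range v, g (2 * (u + j) + s) := Finset.sum_nonneg fun _ _ => hg _
  have h3 : 2 * (w : ℤ) ≤ ∑ j ∈ Finset.range w, g (2 * (u + v + j) + s) := by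
    simpa [mul_comm] using Finset.card_nsmul_le_sum (Finset.range w)
      (fun j => g (2 * (u + v + j) + s)) 2 (by simpa using hw)
  linarith

namespace RectPolygon

variable {n : ℕ}

theorem sum_dvec [NeZero n] (P : RectPolygon n) : ∑ i : ZMod n, P.dvec i = 0 := by
  simp only [dvec, Finset.sum_sub_distrib]
  rw [sub_eq_zero]
  exact Equiv.sum_comp (Equiv.addRight 1) P.v

/-- A rectilinear polygon has a frame of lattice unit vectors `(p, q)` and `(-q, p)` such that the
edge with index `0` points in the direction `(p, q)`. -/
theorem exists_frame (P : RectPolygon n) :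
    ∃ p q : ℤ, (p = 1 ∧ q = 0 ∨ p = -1 ∧ q = 0 ∨ p = 0 ∧ q = 1 ∨ p = 0 ∧ q = -1) ∧
      0 < p * (P.dvec 0).1 + q * (P.dvec 0).2 ∧ p * (P.dvec 0).2 - q * (P.dvec 0).1 = 0 := by
  have h1 := P.nondeg 0
  have h2 := P.axis 0
  rw [ne_eq, Prod.ext_iff] at h1
  simp only [dvec, Prod.fst_sub, Prod.snd_sub]
  rcases h2 with h2 | h2
  · rcases lt_or_ge (P.v 0).2 (P.v (0 + 1)).2 with h | h
    · exact ⟨0, 1, by simp, by omega, by omega⟩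
    · exact ⟨0, -1, by simp, by omega, by omega⟩
  · rcases lt_or_ge (P.v 0).1 (P.v (0 + 1)).1 with h | h
    · exact ⟨1, 0, by simp, by omega, by omega⟩
    · exact ⟨-1, 0, by simp, by omega, by omega⟩

theorem exists_coordinates [NeZero n] (P : RectPolygon n) :
    ∃ A B : ZMod n → ℤ, (∀ i, A i = 0 ∨ B i = 0) ∧ 0 < A 0 ∧ B 0 = 0 ∧
      (∀ i j, cross (P.dvec i) (P.dvec j) = A i * B j - B i * A j) ∧
      (∀ i, P.elen i = |A i| + |B i|) ∧ ∑ i, A i = 0 ∧ ∑ i, B i = 0 ∧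
      ∀ i j, A i + A j = 0 → B i + B j = 0 → P.dvec i + P.dvec j = 0 := by
  obtain ⟨p, q, hpq, h0, h0'⟩ := P.exists_frame
  have hsum := P.sum_dvec
  rw [Prod.ext_iff, Prod.fst_sum, Prod.snd_sum] at hsum
  have hax : ∀ i, (P.dvec i).1 = 0 ∨ (P.dvec i).2 = 0 := fun i => by
    simpa only [dvec, Prod.fst_sub, Prod.snd_sub, sub_eq_zero] using P.axis i
  refine ⟨fun i => p * (P.dvec i).1 + q * (P.dvec i).2,
    fun i => p * (P.dvec i).2 - q * (P.dvec i).1, fun i => ?_, h0, h0', fun i j => ?_,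
    fun i => ?_, ?_, ?_, fun i j h h' => ?_⟩
  · simp only
    have := hax i
    rcases hpq with ⟨rfl, rfl⟩ | ⟨rfl, rfl⟩ | ⟨rfl, rfl⟩ | ⟨rfl, rfl⟩ <;> omega
  · rw [cross]
    rcases hpq with ⟨rfl, rfl⟩ | ⟨rfl, rfl⟩ | ⟨rfl, rfl⟩ | ⟨rfl, rfl⟩ <;> ring
  · have he : P.elen i = |(P.dvec i).1| + |(P.dvec i).2| := rfl
    rw [he]
    rcases hpq with ⟨rfl, rfl⟩ | ⟨rfl, rfl⟩ | ⟨rfl, rfl⟩ | ⟨rfl, rfl⟩ <;> simp [add_comm]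
  · rw [Finset.sum_add_distrib, ← Finset.mul_sum, ← Finset.mul_sum, hsum.1, hsum.2]
    simp
  · rw [Finset.sum_sub_distrib, ← Finset.mul_sum, ← Finset.mul_sum, hsum.1, hsum.2]
    simp
  · simp only at h h'
    rw [Prod.ext_iff, Prod.fst_add, Prod.snd_add, Prod.fst_zero, Prod.snd_zero]
    rcases hpq with ⟨rfl, rfl⟩ | ⟨rfl, rfl⟩ | ⟨rfl, rfl⟩ | ⟨rfl, rfl⟩ <;> omega

theorem even_perimeter [NeZero n] (P : RectPolygon n) : Even P.perimeter := by
  obtain ⟨A, B, -, -, -, -, hlen, hA, hB, -⟩ := P.exists_coordinates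
  have h : P.perimeter = ∑ i, ((|A i| + A i) + (|B i| + B i)) := by
    simp only [Finset.sum_add_distrib, hA, hB, perimeter, hlen, add_zero]
  rw [h]
  refine Finset.even_sum _ fun i _ => ?_
  rw [Int.even_add, Int.even_add, Int.even_add, even_abs, even_abs]
  tauto

theorem one_le_elen (P : RectPolygon n) (i : ZMod n) : 1 ≤ P.elen i := by
  have h := P.nondeg i
  rw [ne_eq, Prod.ext_iff] at h
  unfold elen
  rw [abs_eq_max_neg, abs_eq_max_neg]
  omega

theorem elen_eq_one_of_perimeter_le [NeZero n] (P : RectPolygon n) (h : P.perimeter ≤ n)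
    (i : ZMod n) : P.elen i = 1 := by
  have hsum : ∑ j : ZMod n, (P.elen j - 1) ≤ 0 := by
    simpa [Finset.sum_sub_distrib, ZMod.card, perimeter] using h
  have := Finset.single_le_sum (f := fun j => P.elen j - 1)
    (fun j _ => sub_nonneg.mpr (P.one_le_elen j)) (Finset.mem_univ i)
  have h1 := P.one_le_elen i
  linarith

theorem v_natCast_ne [NeZero n] (P : RectPolygon n) {k l : ℕ} (hk : k < n)
    (hl : l < n) (h1 : k + 1 < l) (h2 : l + 1 < n + k) : P.v k ≠ P.v l := by
  intro h
  have hseg : ∀ x y : ℤ × ℤ, onSeg x y x := fun x y =>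
    ⟨min_le_left _ _, le_max_left _ _, min_le_left _ _, le_max_left _ _⟩
  have hinj : ∀ {s t : ℕ}, s < n → t < n → (s : ZMod n) = t → s = t := fun hs ht hst => by
    rw [← ZMod.val_cast_of_lt hs, hst, ZMod.val_cast_of_lt ht]
  rcases P.simple k l (fun h => by have := hinj hl hk h; omega) (P.v k) (hseg _ _)
    (by rw [h]; exact hseg _ _) with ⟨h, -⟩ | ⟨h, -⟩
  · rw [← Nat.cast_succ] at h
    have := hinj hl (by omega) h
    omega
  · rw [← Nat.cast_succ] at h
    rcases (Nat.succ_le_of_lt hl).lt_or_eq with hl' | hl'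
    · have := hinj hk hl' h
      omega
    · rw [hl', ZMod.natCast_self, ← Nat.cast_zero] at h
      have := hinj hk (NeZero.pos n) h
      omega

end RectPolygon

theorem realizes.exists_directions {a b c d : ℕ}
    {P : RectPolygon (2 * (a + b + c + d) + 4)} (hP : realizes (xySeq b c d a) P) :
    ∃ A B : ZMod (2 * (a + b + c + d) + 4) → ℤ,
      (∀ i, P.elen i = |A i| + |B i|) ∧ ∑ i, A i = 0 ∧ ∑ i, B i = 0 ∧
      (∀ i j, A i + A j = 0 → B i + B j = 0 → P.dvec i + P.dvec j = 0) ∧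
      ∀ k : ℕ, k < 2 * (a + b + c + d) + 4 →
        (k % 2 = 0 → B k = 0 ∧ ((k ≤ 2 * b ∨ 2 * (b + c + d) + 4 ≤ k) ∧ 0 < A k ∨
          (2 * b < k ∧ k < 2 * (b + c + d) + 4) ∧ A k < 0)) ∧
        (k % 2 = 1 → A k = 0 ∧
          (k ≤ 2 * (b + c) + 1 ∧ 0 < B k ∨ 2 * (b + c) + 1 < k ∧ B k < 0)) := by
  obtain ⟨A, B, hAB, hA, hB, hcross, hlen, hsA, hsB, hopp⟩ := P.exists_coordinates
  obtain ⟨hlength, -, hturn⟩ := hP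
  refine ⟨A, B, hlen, hsA, hsB, hopp, fun k hk =>
    turn_directions (A := fun k => A k) (B := fun k => B k) (fun k _ => hAB k) (by simpa using hA)
      (by simpa using hB) (fun k hk hI => ?_) (fun k hk hI => ?_) hk⟩
  · have h := (hturn ⟨k + 1, hlength ▸ hk⟩).1.mp ((xySeq_get_eq_true_iff ..).mpr hI)
    rw [RectPolygon.convexAt, hcross] at h
    simpa using h
  · have h := (hturn ⟨k + 1, hlength ▸ hk⟩).2.mp
      (Bool.eq_false_iff.mpr ((xySeq_get_eq_true_iff ..).not.mpr hI))
    rw [RectPolygon.reflexAt, hcross] at h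
    simpa using h

theorem realizes.le_perimeter {a b c d : ℕ} {P : RectPolygon (2 * (a + b + c + d) + 4)}
    (hP : realizes (xySeq b c d a) P) :
    2 * (a + b + 1 : ℤ) + 2 * max (b + c + 1) (a + d + 1) ≤ P.perimeter := by
  obtain ⟨A, B, hlen, hA, hB, -, hdir⟩ := hP.exists_directions
  have hper : P.perimeter = ∑ i, |A i| + ∑ i, |B i| := by
    simp only [RectPolygon.perimeter, hlen, Finset.sum_add_distrib]
  have hAp : ∑ i, |A i| = ∑ i, (|A i| + A i) := by rw [Finset.sum_add_distrib, hA, add_zero]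
  have hBp : ∑ i, |B i| = ∑ i, (|B i| + B i) := by rw [Finset.sum_add_distrib, hB, add_zero]
  have hBn : ∑ i, |B i| = ∑ i, (|B i| - B i) := by rw [Finset.sum_sub_distrib, hB, sub_zero]
  have h1 : 2 * (a + b + 1 : ℤ) ≤ ∑ i, |A i| := by
    rw [hAp, ZMod.sum_eq_sum_range]
    have := Finset.two_mul_le_sum_range (g := fun k => |A k| + A k) (u := b + 1) (v := c + d + 1)
      (w := a) (s := 0) two_pos (fun k => by linarith [neg_abs_le (A k)]) (fun j hj => ?_)
      fun j hj => ?_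
    · rw [show 2 * (b + 1 + (c + d + 1) + a) = 2 * (a + b + c + d) + 4 by ring] at this
      push_cast at this
      linarith
    · have := ((hdir (2 * j + 0) (by omega)).1 (by omega)).2
      rw [abs_eq_max_neg]
      omega
    · have := ((hdir (2 * (b + 1 + (c + d + 1) + j) + 0) (by omega)).1 (by omega)).2
      rw [abs_eq_max_neg]
      omega
  have h2 : 2 * (b + c + 1 : ℤ) ≤ ∑ i, |B i| := by
    rw [hBp, ZMod.sum_eq_sum_range]
    have := Finset.two_mul_le_sum_range (g := fun k => |B k| + B k) (u := b + c + 1)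
      (v := a + d + 1) (w := 0) (s := 1) one_lt_two (fun k => by linarith [neg_abs_le (B k)])
      (fun j hj => ?_) fun j hj => (Nat.not_lt_zero j hj).elim
    · rw [show 2 * (b + c + 1 + (a + d + 1) + 0) = 2 * (a + b + c + d) + 4 by ring] at this
      push_cast at this
      linarith
    · have := ((hdir (2 * j + 1) (by omega)).2 (by omega)).2
      rw [abs_eq_max_neg]
      omega
  have h3 : 2 * (a + d + 1 : ℤ) ≤ ∑ i, |B i| := by
    rw [hBn, ZMod.sum_eq_sum_range]
    have := Finset.two_mul_le_sum_range (g := fun k => |B k| - B k) (u := 0)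
      (v := b + c + 1) (w := a + d + 1) (s := 1) one_lt_two
      (fun k => by linarith [le_abs_self (B k)]) (fun j hj => (Nat.not_lt_zero j hj).elim)
      fun j hj => ?_
    · rw [show 2 * (0 + (b + c + 1) + (a + d + 1)) = 2 * (a + b + c + d) + 4 by ring] at this
      push_cast at this
      linarith
    · have := ((hdir (2 * (0 + (b + c + 1) + j) + 1) (by omega)).2 (by omega)).2
      rw [abs_eq_max_neg]
      omega
  omega

theorem realizes.length_lt_perimeter {a b c d : ℕ} {P : RectPolygon (2 * (a + b + c + d) + 4)}
    (hP : realizes (xySeq b c d a) P)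
    (h : (b = 0 ∧ d = 0 ∧ 0 < a ∧ 0 < c) ∨ (a = 0 ∧ c = 0 ∧ 0 < b ∧ 0 < d)) :
    2 * (a + b + c + d : ℤ) + 4 < P.perimeter := by
  by_contra! hle
  have hunit := P.elen_eq_one_of_perimeter_le (by exact_mod_cast hle)
  obtain ⟨A, B, hlen, -, -, hopp, hdir⟩ := hP.exists_directions
  simp only [hlen, abs_eq_max_neg] at hunit
  have hv : ∀ k : ℕ, P.v (k + 1 : ℕ) = P.v k + P.dvec k := fun k => by
    simp [RectPolygon.dvec]
  obtain ⟨m, hm⟩ : ∃ m, 2 * (a + b + c + d) + 4 = m + 8 := ⟨2 * (a + b + c + d) - 4, by omega⟩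
  have hlast : P.v (0 : ℕ) = P.v (m + 7 : ℕ) + P.dvec (m + 7 : ℕ) := by
    rw [← hv, show m + 7 + 1 = _ from hm.symm, ZMod.natCast_self, Nat.cast_zero]
  have h0 := hdir 0 (by omega)
  have h1 := hdir 1 (by omega)
  have h2 := hdir 2 (by omega)
  have h6 := hdir (m + 6) (by omega)
  have h7 := hdir (m + 7) (by omega)
  have u0 := hunit (0 : ℕ)
  have u1 := hunit (1 : ℕ)
  have u2 := hunit (2 : ℕ)
  have u6 := hunit (m + 6 : ℕ)
  have u7 := hunit (m + 7 : ℕ)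
  have v1 : P.v (1 : ℕ) = P.v (0 : ℕ) + P.dvec (0 : ℕ) := hv 0
  have v2 : P.v (2 : ℕ) = P.v (1 : ℕ) + P.dvec (1 : ℕ) := hv 1
  have v3 : P.v (3 : ℕ) = P.v (2 : ℕ) + P.dvec (2 : ℕ) := hv 2
  have v7 : P.v (m + 7 : ℕ) = P.v (m + 6 : ℕ) + P.dvec (m + 6 : ℕ) := hv (m + 6)
  have o1 : P.dvec (1 : ℕ) + P.dvec (m + 7 : ℕ) = 0 := by
    apply hopp <;>
    · generalize A (1 : ℕ) = x1, A (m + 7 : ℕ) = x7, B (1 : ℕ) = y1, B (m + 7 : ℕ) = y7 at *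
      clear hdir hopp hlen hunit
      omega
  rcases h with h | h
  · refine P.v_natCast_ne (k := 3) (l := m + 7) (by omega) (by omega) (by omega) (by omega) ?_
    have o2 : P.dvec (0 : ℕ) + P.dvec (2 : ℕ) = 0 := by
      apply hopp <;>
      · generalize A (0 : ℕ) = x0, A (2 : ℕ) = x2, B (0 : ℕ) = y0, B (2 : ℕ) = y2 at *
        clear hdir hopp hlen hunit
        omega
    rw [v3, v2, v1, hlast]
    linear_combination o1 + o2
  · refine P.v_natCast_ne (k := 2) (l := m + 6) (by omega) (by omega) (by omega) (by omega) ?_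
    have o2 : P.dvec (0 : ℕ) + P.dvec (m + 6 : ℕ) = 0 := by
      apply hopp <;>
      · generalize A (0 : ℕ) = x0, A (m + 6 : ℕ) = x6, B (0 : ℕ) = y0, B (m + 6 : ℕ) = y6 at *
        clear hdir hopp hlen hunit
        omega
    rw [v2, v1, hlast, v7]
    linear_combination o1 + o2

/-- The minimum perimeter of an xy-monotone polygon with stair reflex-counts
`(r₁, r₂, r₃, r₄)` for the stairs TR, TL, BL, BR (with `r(T) ≥ r(B)`, i.e.
`r₁ + r₂ ≥ r₃ + r₄`, and at least one reflex vertex): `4r₁ + 6` in case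
`(r₁,0,r₁,0)`, `4r₂ + 6` in case `(0,r₂,0,r₂)`, and otherwise
`3(r₁+r₂) + (r₃+r₄) + |r₂ + r₃ − r₁ − r₄| + 4`. -/
theorem xy_monotone_min_perimeter (r1 r2 r3 r4 : ℕ)
    (hpos : 0 < r1 + r2 + r3 + r4) (hTB : r3 + r4 ≤ r1 + r2)
    (P : RectPolygon (2 * (r1 + r2 + r3 + r4) + 4))
    (hreal : realizes (xySeq r2 r3 r4 r1) P)
    (hmin : ∀ P' : RectPolygon (2 * (r1 + r2 + r3 + r4) + 4),
      realizes (xySeq r2 r3 r4 r1) P' → P.perimeter ≤ P'.perimeter) :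
    P.perimeter =
      if r2 = 0 ∧ r3 = r1 ∧ r4 = 0 then 4 * (r1 : ℤ) + 6
      else if r1 = 0 ∧ r3 = 0 ∧ r4 = r2 then 4 * (r2 : ℤ) + 6
      else 3 * ((r1 : ℤ) + r2) + ((r3 : ℤ) + r4) + |(r2 : ℤ) + r3 - r1 - r4| + 4 := by
  have hle := hreal.le_perimeter
  have hge : ∀ H : ℕ, r2 + r3 < H → r1 + r4 < H → r3 + 1 < r2 + H → r4 + 1 < r1 + H →
      P.perimeter ≤ 2 * (r1 + r2 + 1) + 2 * H := fun H hL hR h1 h2 =>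
    (hmin _ (stairPolygon_realizes hTB hL hR h1 h2)).trans_eq
      (stairPolygon_perimeter hTB hL hR h1 h2)
  obtain ⟨m, hm⟩ := P.even_perimeter
  rw [abs_eq_max_neg]
  split_ifs with h h'
  · have := hge (r1 + 2) (by omega) (by omega) (by omega) (by omega)
    have := hreal.length_lt_perimeter (by omega)
    omega
  · have := hge (r2 + 2) (by omega) (by omega) (by omega) (by omega)
    have := hreal.length_lt_perimeter (by omega)
    omega
  · have := hge (max (r2 + r3) (r1 + r4) + 1) (by omega) (by omega) (by omega) (by omega)
    omega
end
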